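/- arXiv:2007.00152 — 7 statements merged into one kernel-verified Lean document; each statement's English description precedes it below -/
import Mathlib

section
/- For every positive integer n, the diagonal Ramsey number of the fan satisfies r(F_n) ≤ 11n/2 + 6. Equivalently: if N is any integer with N ≥ 11n/2 + 6 (for instance N = ⌈11n/2⌉ + 6), then every red-blue coloring of the edges of the complete graph K_N contains a monochromatic copy of F_n. -/
/-- The fan `F n`: vertex `0` is the center, adjacent to all other `2n` vertices,
and the vertices `2i+1`, `2i+2` (for `0 ≤ i < n`) form `n` pairwise disjoint edges. -/
def fanGraph (n : ℕ) : SimpleGraph (Fin (2 * n + 1)) :=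
  SimpleGraph.fromRel (fun a b => a.val = 0 ∨ (a.val % 2 = 1 ∧ b.val = a.val + 1))

/-- `H` is contained in `G` as a (not necessarily induced) subgraph. -/
def Contains {α β : Type*} (H : SimpleGraph α) (G : SimpleGraph β) : Prop :=
  ∃ f : α → β, Function.Injective f ∧ ∀ ⦃a b⦄, H.Adj a b → G.Adj (f a) (f b)

open Finset

theorem exists_labels_of_no_perfect_involution {W : Type*} [Fintype W] [DecidableEq W]
    (J : SimpleGraph W) (heven : Even (Fintype.card W))
    (h : ¬ ∃ p : W → W, (∀ x, p (p x) = x) ∧ ∀ x, J.Adj x (p x)) :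
    ∃ (u : Finset W) (f : W → W), (∀ x ∉ u, ∀ y ∉ u, J.Adj x y → f x = f y) ∧
      #u + 2 ≤ #(uᶜ.image f) := by
  classical
  have hM : ¬ ∃ M : J.Subgraph, M.IsPerfectMatching := by
    rintro ⟨M, hM⟩
    choose p hp using fun x => hM.1 (hM.2 x)
    exact h ⟨p, fun x => ((hp (p x)).2 x (hp x).1.symm).symm, fun x => (hp x).1.adj_sub⟩
  rw [J.tutte] at hM
  push Not at hM
  obtain ⟨u, hu⟩ := hM
  rw [SimpleGraph.IsTutteViolator] at hu
  set H := (⊤ : J.Subgraph).deleteVerts u with hH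
  have hv : ∀ x, x ∈ H.verts ↔ x ∉ u := by simp [hH]
  have hpar := SimpleGraph.odd_ncard_oddComponents (G := H.coe)
  have hcard : Nat.card H.verts + u.ncard = Fintype.card W := by
    have : H.verts = uᶜ := by ext x; simp [hv]
    rw [Nat.card_coe_set_eq, this, add_comm, Set.ncard_add_ncard_compl, Nat.card_eq_fintype_card]
  have h2 : u.ncard + 2 ≤ H.coe.oddComponents.ncard := by
    grind
  let f : W → W := fun x =>
    if hx : x ∈ H.verts then ((H.coe.connectedComponentMk ⟨x, hx⟩).out : H.verts).1 else x
  refine ⟨u.toFinset, f, ?_, ?_⟩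
  · intro x hx y hy hxy
    have hx' : x ∈ H.verts := (hv x).2 (by simpa using hx)
    have hy' : y ∈ H.verts := (hv y).2 (by simpa using hy)
    have : H.coe.connectedComponentMk ⟨x, hx'⟩ = H.coe.connectedComponentMk ⟨y, hy'⟩ := by
      apply SimpleGraph.ConnectedComponent.sound
      apply SimpleGraph.Adj.reachable
      simp only [SimpleGraph.Subgraph.coe_adj, hH, SimpleGraph.Subgraph.deleteVerts_adj]
      simp_all
    simp only [f, hx', hy', dif_pos, this]
  · rw [← Set.ncard_eq_toFinset_card']
    refine h2.trans ?_
    rw [← Set.ncard_coe_finset]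
    refine Set.ncard_le_ncard_of_injOn (fun c => (c.out : H.verts).1) ?_ ?_
    · intro c _
      have hc : (c.out : H.verts).1 ∉ u := (hv _).1 c.out.2
      simp only [coe_image, Set.mem_image, mem_coe, mem_compl, Set.mem_toFinset]
      refine ⟨_, hc, ?_⟩
      simp only [f, c.out.2, dif_pos]
      congr 2
      exact Quot.out_eq c
    · intro c _ d _ hcd
      have := Subtype.ext hcd
      rw [← Quot.out_eq c, ← Quot.out_eq d, this]

/-- `G` has a matching of size `n` inside the vertex set `A`. -/
def HasMatching {V : Type*} (G : SimpleGraph V) (A : Finset V) (n : ℕ) : Prop :=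
  ∃ g h : Fin n → V, Function.Injective g ∧ Function.Injective h ∧ (∀ i j, g i ≠ h j) ∧
    ∀ i, g i ∈ A ∧ h i ∈ A ∧ G.Adj (g i) (h i)

/-- The join of the induced subgraph `G[A]` with a complete graph on `t` vertices. -/
def joinComplete {V : Type*} (G : SimpleGraph V) (A : Finset V) (t : ℕ) :
    SimpleGraph (A ⊕ Fin t) where
  Adj x y := x ≠ y ∧ ∀ a b : A, x = .inl a → y = .inl b → G.Adj a b
  symm := ⟨fun _ _ h => ⟨h.1.symm, fun a b ha hb => (h.2 b a hb ha).symm⟩⟩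
  loopless := ⟨fun _ h => h.1 rfl⟩

theorem hasMatching_of_perfect_involution {V : Type*} (G : SimpleGraph V) (A : Finset V)
    {n t : ℕ} (ht : t + 2 * n ≤ #A) (p : A ⊕ Fin t → A ⊕ Fin t) (hp : ∀ x, p (p x) = x)
    (hadj : ∀ x, (joinComplete G A t).Adj x (p x)) : HasMatching G A n := by
  classical
  let r := Fintype.equivFin A
  let B₁ : Finset A := {a | ∃ b : A, p (.inl a) = .inl b ∧ r a < r b}
  let B₂ : Finset A := {a | ∃ b : A, p (.inl a) = .inl b ∧ r b < r a}
  let B₃ : Finset A := {a | ∃ j, p (.inl a) = .inr j}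
  have hpinj : Function.Injective p := Function.LeftInverse.injective hp
  have hcover : (univ : Finset A) ⊆ B₁ ∪ (B₂ ∪ B₃) := by
    intro a _
    simp only [B₁, B₂, B₃, mem_union, mem_filter, mem_univ, true_and]
    rcases hpa : p (.inl a) with b | j
    · have hne : a ≠ b := by
        rintro rfl
        exact (hadj (.inl a)).1 hpa.symm
      rcases lt_or_gt_of_ne (fun h => hne (r.injective h) : r a ≠ r b) with h | h
      · exact .inl ⟨b, rfl, h⟩
      · exact .inr (.inl ⟨b, rfl, h⟩)
    · exact .inr (.inr ⟨j, rfl⟩)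
  have h₂ : #B₂ ≤ #B₁ := by
    have : ∀ a ∈ B₂, ∃ b ∈ B₁, p (.inl a) = .inl b := by
      intro a ha
      obtain ⟨b, hb, hlt⟩ : ∃ b : A, p (.inl a) = .inl b ∧ r b < r a := by simpa [B₂] using ha
      refine ⟨b, ?_, hb⟩
      simp only [B₁, mem_filter, mem_univ, true_and]
      exact ⟨a, by rw [← hb, hp], hlt⟩
    choose! q hq hpq using this
    refine card_le_card_of_injOn q hq fun a ha b hb hab => ?_
    have := hpq a ha
    rw [hab, ← hpq b hb] at this
    exact Sum.inl_injective (hpinj this)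
  have h₃ : #B₃ ≤ t := by
    have h := card_le_card_of_injOn (s := B₃) (t := univ.map (.inr : Fin t ↪ A ⊕ Fin t))
      (fun a => p (.inl a)) ?_ (fun a _ b _ hab => Sum.inl_injective (hpinj hab))
    · simpa using h
    · intro a ha
      obtain ⟨j, hj⟩ : ∃ j, p (.inl a) = .inr j := by simpa [B₃] using ha
      simp [hj]
  have hn : n ≤ #B₁ := by
    have h := card_le_card hcover
    have h' := card_union_le B₁ (B₂ ∪ B₃)
    have h'' := card_union_le B₂ B₃
    rw [card_univ, Fintype.card_coe] at h
    omega
  obtain ⟨B, hB, hBn⟩ := exists_subset_card_eq hn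
  let e := (B.equivFinOfCardEq hBn).symm
  have he : ∀ i, ∃ b : A, p (.inl (e i).1) = .inl b ∧ r (e i).1 < r b := fun i => by
    simpa [B₁] using hB (e i).2
  choose q hq hlt using he
  refine ⟨fun i => (e i).1.1, fun i => (q i).1, ?_, ?_, ?_, ?_⟩
  · intro i j hij
    exact e.injective (Subtype.ext (Subtype.ext hij))
  · intro i j hij
    have : q i = q j := Subtype.ext hij
    have h := hq i
    rw [this, ← hq j] at h
    exact e.injective (Subtype.ext (Sum.inl_injective (hpinj h)))
  · intro i j hij
    have hij : (e i).1 = q j := Subtype.ext hij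
    have h : q i = (e j).1 := by
      apply Sum.inl_injective (β := Fin t)
      rw [← hq i, hij, ← hq j, hp]
    have := hlt i
    have h2 := hlt j
    rw [hij, h] at this
    exact lt_asymm this h2
  · intro i
    refine ⟨(e i).1.2, (q i).2, ?_⟩
    exact (hadj (.inl (e i).1)).2 _ _ rfl (hq i)

/-- The Tutte-Berge formula, in the form of a deficient vertex set `S` and a labelling `f` of the
remaining vertices by connected components. -/
theorem exists_labels_of_not_hasMatching {V : Type*} (G : SimpleGraph V) (A : Finset V) {n : ℕ}
    [DecidableEq V] (hA : 2 * n ≤ #A) (h : ¬ HasMatching G A n) :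
    ∃ S ⊆ A, ∃ f : V → ℕ, (∀ x ∈ A \ S, ∀ y ∈ A \ S, G.Adj x y → f x = f y) ∧
      #A + #S + 2 ≤ #((A \ S).image f) + 2 * n := by
  classical
  obtain ⟨t, ht⟩ := Nat.exists_eq_add_of_le hA
  obtain ⟨u, f, hf, hu⟩ := exists_labels_of_no_perfect_involution (joinComplete G A t)
    (by simp only [Fintype.card_sum, Fintype.card_coe, Fintype.card_fin]; grind)
    (fun ⟨p, hp, hadj⟩ => h (hasMatching_of_perfect_involution G A (by omega) p hp hadj))
  have hall : ∀ j : Fin t, .inr j ∈ u := by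
    intro j
    by_contra hj
    have hconst : ∀ x ∈ uᶜ, f x = f (.inr j) := by
      intro x hx
      by_cases hxj : x = .inr j
      · rw [hxj]
      · exact hf x (by simpa using hx) _ hj ⟨hxj, by simp⟩
    have : uᶜ.image f ⊆ {f (.inr j)} := image_subset_iff.2 fun x hx => mem_singleton.2 (hconst x hx)
    have := (card_le_card this).trans (card_singleton _).le
    omega
  let e := Fintype.equivFin (A ⊕ Fin t)
  let S : Finset V := A.filter fun x => ∃ h : x ∈ A, .inl ⟨x, h⟩ ∈ u
  have hS : ∀ x (hx : x ∈ A), x ∈ A \ S ↔ .inl ⟨x, hx⟩ ∉ u := by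
    intro x hx
    simp [S, hx]
  refine ⟨S, filter_subset _ _, fun x => if hx : x ∈ A then e (f (.inl ⟨x, hx⟩)) else 0, ?_, ?_⟩
  · intro x hx y hy hxy
    have hxA := (mem_sdiff.1 hx).1
    have hyA := (mem_sdiff.1 hy).1
    simp only [hxA, hyA, dif_pos]
    rw [hf _ ((hS x hxA).1 hx) _ ((hS y hyA).1 hy)]
    refine ⟨by simpa using hxy.ne, ?_⟩
    rintro a b ha hb
    obtain rfl := Sum.inl_injective ha
    obtain rfl := Sum.inl_injective hb
    exact hxy
  · have hcard : #S + t ≤ #u := by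
      have h1 : #(S.subtype (· ∈ A)) = #S := by
        rw [card_subtype, filter_true_of_mem]
        exact fun x hx => (mem_filter.1 hx).1
      have h2 : (S.subtype (· ∈ A)).disjSum (univ : Finset (Fin t)) ⊆ u := by
        intro x hx
        rcases x with x | j
        · simp only [inl_mem_disjSum, mem_subtype, S, mem_filter] at hx
          exact hx.2.2
        · exact hall j
      have := card_le_card h2
      rw [card_disjSum, h1] at this
      simpa using this
    have himg : #(uᶜ.image f) ≤
        #((A \ S).image fun x => if hx : x ∈ A then (e (f (.inl ⟨x, hx⟩)) : ℕ) else 0) := by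
      refine card_le_card_of_injOn (fun w => (e w : ℕ)) ?_
        (fun a _ b _ hab => e.injective (Fin.ext hab))
      intro w hw
      obtain ⟨x, hx, rfl⟩ := mem_image.1 (mem_coe.1 hw)
      rcases x with x | j
      · refine mem_coe.2 (mem_image.2 ⟨x, (hS x x.2).2 (by simpa using hx), ?_⟩)
        simp
      · exact absurd (hall j) (by simpa using hx)
    omega

theorem HasMatching.mono {V : Type*} {G : SimpleGraph V} {A B : Finset V} {n : ℕ}
    (h : HasMatching G A n) (hAB : A ⊆ B) : HasMatching G B n := by
  obtain ⟨g, k, hg, hk, hgk, hA⟩ := h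
  exact ⟨g, k, hg, hk, hgk, fun i => ⟨hAB (hA i).1, hAB (hA i).2.1, (hA i).2.2⟩⟩

/-- The neighbours of `v` as a finset. -/
noncomputable def nbrs {V : Type*} [Fintype V] (G : SimpleGraph V) (v : V) : Finset V :=
  (Set.toFinite (G.neighborSet v)).toFinset

@[simp]
theorem mem_nbrs {V : Type*} [Fintype V] {G : SimpleGraph V} {v w : V} :
    w ∈ nbrs G v ↔ G.Adj v w := by
  simp [nbrs]

theorem contains_fanGraph_of_hasMatching {V : Type*} [Fintype V] {G : SimpleGraph V} {v : V}
    {n : ℕ} (h : HasMatching G (nbrs G v) n) : Contains (fanGraph n) G := by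
  obtain ⟨g, k, hg, hk, hgk, hA⟩ := h
  simp only [mem_nbrs] at hA
  have hvg : ∀ i, g i ≠ v := fun i => (hA i).1.ne'
  have hvk : ∀ i, k i ≠ v := fun i => (hA i).2.1.ne'
  let φ : Fin (2 * n + 1) → V := fun x =>
    if h₀ : x.1 = 0 then v
    else if h : x.1 % 2 = 1 then g ⟨x.1 / 2, by omega⟩ else k ⟨x.1 / 2 - 1, by omega⟩
  have hφ : ∀ a b : Fin (2 * n + 1), a.1 = 0 ∨ (a.1 % 2 = 1 ∧ b.1 = a.1 + 1) → a ≠ b →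
      G.Adj (φ a) (φ b) := by
    rintro a b (ha | ⟨ha, hb⟩) hab
    · have hb : b.1 ≠ 0 := fun hb => hab (Fin.ext (ha.trans hb.symm))
      have hφa : φ a = v := dif_pos ha
      rw [hφa]
      by_cases hb' : b.1 % 2 = 1
      · have hφb : φ b = g ⟨b.1 / 2, by omega⟩ := (dif_neg hb).trans (dif_pos hb')
        rw [hφb]
        exact (hA _).1
      · have hφb : φ b = k ⟨b.1 / 2 - 1, by omega⟩ := (dif_neg hb).trans (dif_neg hb')
        rw [hφb]
        exact (hA _).2.1
    · have ha0 : a.1 ≠ 0 := by omega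
      have hb0 : b.1 ≠ 0 := by omega
      have hb' : ¬ b.1 % 2 = 1 := by omega
      have hφa : φ a = g ⟨a.1 / 2, by omega⟩ := (dif_neg ha0).trans (dif_pos ha)
      have hφb : φ b = k ⟨a.1 / 2, by omega⟩ :=
        ((dif_neg hb0).trans (dif_neg hb')).trans (congrArg k (Fin.ext (by simp only; omega)))
      rw [hφa, hφb]
      exact (hA _).2.2
  refine ⟨φ, ?_, ?_⟩
  · intro a b hab
    simp only [φ] at hab
    apply Fin.ext
    split_ifs at hab with h1 h2 h3 h4 h5 h6 h7 h8
    all_goals first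
      | omega
      | exact absurd hab (hvg _)
      | exact absurd hab (hvk _)
      | exact absurd hab.symm (hvg _)
      | exact absurd hab.symm (hvk _)
      | exact absurd hab (hgk _ _)
      | exact absurd hab.symm (hgk _ _)
      | (have := congrArg Fin.val (hg hab); simp only at this; omega)
      | (have := congrArg Fin.val (hk hab); simp only at this; omega)
  · intro a b hab
    rw [fanGraph, SimpleGraph.fromRel_adj] at hab
    rcases hab.2 with h | h
    · exact hφ a b h hab.1
    · exact (hφ b a h hab.1.symm).symm

theorem card_nbrs_add_card_nbrs_compl {V : Type*} [Fintype V] (G : SimpleGraph V) (v : V) :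
    #(nbrs G v) + #(nbrs Gᶜ v) + 1 = Fintype.card V := by
  classical
  have h : nbrs Gᶜ v = univ \ insert v (nbrs G v) := by
    ext w
    simp [eq_comm]
  have hv : #(insert v (nbrs G v)) = #(nbrs G v) + 1 := card_insert_of_notMem (by simp)
  have := card_sdiff_add_card_eq_card (subset_univ (insert v (nbrs G v)))
  rw [← h, hv, card_univ] at this
  omega

theorem exists_isClique_compl_of_labels {V : Type*} {G : SimpleGraph V} {A : Finset V}
    {f : V → ℕ} (hf : ∀ x ∈ A, ∀ y ∈ A, G.Adj x y → f x = f y) :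
    ∃ K ⊆ A, Gᶜ.IsClique (K : Set V) ∧ #K = #(A.image f) := by
  classical
  obtain ⟨K, hKA, hinj, hK⟩ := exists_subset_injOn_image_eq_of_surjOn (f := f) (A : Set V)
    (A.image f) (by simpa using Set.surjOn_image f (A : Set V))
  rw [coe_subset] at hKA
  refine ⟨K, hKA, fun x hx y hy hxy => ?_, by rw [← hK, card_image_of_injOn hinj]⟩
  exact (SimpleGraph.compl_adj _ _ _).2
    ⟨hxy, fun hadj => hxy (hinj hx hy (hf x (hKA hx) y (hKA hy) hadj))⟩

theorem card_image_le_card_filter_ne_add_one {V : Type*} (A : Finset V) (f : V → ℕ) (l : ℕ) :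
    #(A.image f) ≤ #{x ∈ A | ¬ f x = l} + 1 := by
  have hsub : A.image f ⊆ insert l ({x ∈ A | ¬ f x = l}.image f) := by
    intro c hc
    obtain ⟨x, hx, rfl⟩ := mem_image.1 hc
    by_cases hxl : f x = l
    · simp [hxl]
    · exact mem_insert_of_mem (mem_image_of_mem f (mem_filter.2 ⟨hx, hxl⟩))
  exact (card_le_card hsub).trans
    ((card_insert_le _ _).trans (Nat.add_le_add_right card_image_le 1))

/-- If the union of all label classes but one is large, the complementary colour forces a large
clique inside one label class. -/
theorem exists_isClique_of_labels_of_large {V : Type*} [Fintype V] [DecidableEq V]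
    {G : SimpleGraph V} {n : ℕ} (hB : ∀ x, ¬ HasMatching Gᶜ (nbrs Gᶜ x) n) {A : Finset V}
    {f : V → ℕ} (hf : ∀ x ∈ A, ∀ y ∈ A, G.Adj x y → f x = f y) {l : ℕ} (hl : l ∈ A.image f)
    (hT : 2 * n + #{x ∈ A | f x = l} ≤ #A) :
    ∃ (s : ℕ) (K : Finset V), G.IsClique (K : Set V) ∧
      #A + s + 2 ≤ #K + 2 * n + #{x ∈ A | f x = l} ∧ #(A.image f) ≤ s + 2 ∧ s + 1 ≤ n := by
  obtain ⟨x, hxA, rfl⟩ := mem_image.1 hl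
  have hcompl : ∀ a ∈ A, ∀ b ∈ A, f a ≠ f b → Gᶜ.Adj a b := fun a ha b hb hab =>
    (SimpleGraph.compl_adj _ _ _).2 ⟨fun h => hab (congrArg f h), fun h => hab (hf a ha b hb h)⟩
  have hTcard := card_filter_add_card_filter_not (s := A) (fun y => f y = f x)
  set T : Finset V := A.filter fun y => ¬ f y = f x with hTdef
  have hTA : ∀ y ∈ T, y ∈ A := fun y hy => (mem_filter.1 hy).1
  have hTx : T ⊆ nbrs Gᶜ x := fun y hy =>
    mem_nbrs.2 (hcompl x hxA y (hTA y hy) (Ne.symm (mem_filter.1 hy).2))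
  obtain ⟨S, hST, f', hf', hcard⟩ := exists_labels_of_not_hasMatching Gᶜ T (n := n) (by omega)
    fun h => hB x (h.mono hTx)
  have hTS : #(T \ S) + #S = #T := card_sdiff_add_card_eq_card hST
  have himg : #((T \ S).image f') ≤ #(T \ S) := card_image_le
  have hconst : ∀ a ∈ T \ S, ∀ b ∈ T \ S, f a = f b := by
    intro a ha b hb
    by_contra hab
    have hmem : ∀ z ∈ T \ S, z ∈ A := fun z hz => hTA z (mem_sdiff.1 hz).1
    have hsub : (T \ S).image f' ⊆ {f' a} := by
      refine image_subset_iff.2 fun z hz => mem_singleton.2 ?_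
      by_cases hza : f z = f a
      · rw [hf' z hz b hb (hcompl z (hmem z hz) b (hmem b hb) (hza ▸ hab)),
          hf' a ha b hb (hcompl a (hmem a ha) b (hmem b hb) hab)]
      · exact hf' z hz a ha (hcompl z (hmem z hz) a (hmem a ha) hza)
    have := (card_le_card hsub).trans (card_singleton _).le
    omega
  obtain ⟨K, -, hK, hKcard⟩ := exists_isClique_compl_of_labels hf'
  rw [compl_compl] at hK
  refine ⟨#S, K, hK, by omega, ?_, by omega⟩
  obtain ⟨a, ha⟩ : (T \ S).Nonempty := by
    rw [← card_pos]
    omega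
  have hsub : A.image f ⊆ insert (f x) (insert (f a) (S.image f)) := by
    refine image_subset_iff.2 fun y hy => ?_
    by_cases hyx : f y = f x
    · simp [hyx]
    · have hyT : y ∈ T := mem_filter.2 ⟨hy, hyx⟩
      by_cases hyS : y ∈ S
      · exact mem_insert_of_mem (mem_insert_of_mem (mem_image_of_mem f hyS))
      · simp [hconst y (mem_sdiff.2 ⟨hyT, hyS⟩) a ha]
  have h1 := card_le_card hsub
  have h2 := card_insert_le (f x) (insert (f a) (S.image f))
  have h3 := card_insert_le (f a) (S.image f)
  have h4 : #(S.image f) ≤ #S := card_image_le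
  omega

theorem card_nbrs_lt {V : Type*} [Fintype V] {G : SimpleGraph V} {n : ℕ}
    (hG : ∀ x, ¬ HasMatching G (nbrs G x) n) (hB : ∀ x, ¬ HasMatching Gᶜ (nbrs Gᶜ x) n) (v : V) :
    #(nbrs G v) < 3 * n := by
  classical
  by_contra! hd
  obtain ⟨S, hS, f, hf, hcard⟩ := exists_labels_of_not_hasMatching G (nbrs G v) (by omega) (hG v)
  set A := nbrs G v \ S
  have hAS : #A + #S = #(nbrs G v) := card_sdiff_add_card_eq_card hS
  have himg : #(A.image f) ≤ #A := card_image_le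
  obtain ⟨l, hl, hfib⟩ := exists_card_fiber_lt_of_card_lt_mul (s := A) (t := A.image f) (f := f)
    (n := 3) (by omega)
  have hTcard := card_filter_add_card_filter_not (s := A) (fun y => f y = l)
  have hTimg := card_image_le_card_filter_ne_add_one A f l
  by_cases hT : 2 * n + #{x ∈ A | f x = l} ≤ #A
  · obtain ⟨s, K, -, -, h1, h2⟩ := exists_isClique_of_labels_of_large hB hf hl hT
    omega
  · omega

theorem exists_isClique_of_card_nbrs {V : Type*} [Fintype V] {G : SimpleGraph V} {n : ℕ}
    (hG : ∀ x, ¬ HasMatching G (nbrs G x) n) (hB : ∀ x, ¬ HasMatching Gᶜ (nbrs Gᶜ x) n) {v : V}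
    (hd : 11 * n ≤ 4 * #(nbrs G v)) :
    ∃ K : Finset V, (G.IsClique (K : Set V) ∨ Gᶜ.IsClique (K : Set V)) ∧
      2 * #(nbrs G v) ≤ #K + 4 * n + 1 := by
  classical
  obtain ⟨S, hS, f, hf, hcard⟩ := exists_labels_of_not_hasMatching G (nbrs G v) (by omega) (hG v)
  set A := nbrs G v \ S
  have hAS : #A + #S = #(nbrs G v) := card_sdiff_add_card_eq_card hS
  obtain ⟨l, hl, hfib⟩ := exists_card_fiber_lt_of_card_lt_mul (s := A) (t := A.image f) (f := f)
    (n := 4) (by omega)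
  by_cases hT : 2 * n + #{x ∈ A | f x = l} ≤ #A
  · obtain ⟨s, K, hK, h1, h2, h3⟩ := exists_isClique_of_labels_of_large hB hf hl hT
    exact ⟨K, .inl hK, by omega⟩
  · obtain ⟨K, -, hK, hKcard⟩ := exists_isClique_compl_of_labels hf
    exact ⟨K, .inr hK, by omega⟩

theorem exists_deficient_subset {V : Type*} {G : SimpleGraph V} [DecidableEq V]
    [DecidableRel G.Adj] {P A : Finset V} {n : ℕ} (hPA : Disjoint P A) (hn : n ≤ #P)
    (h : ¬ HasMatching G (P ∪ A) n) :
    ∃ P₀ ⊆ P, #P₀ ≤ n ∧ #{z ∈ A | ∃ p ∈ P₀, G.Adj p z} < #P₀ := by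
  obtain ⟨Q, hQP, hQ⟩ := exists_subset_card_eq hn
  by_contra! hcon
  apply h
  have hall : ∀ s : Finset Q, #s ≤ #(s.biUnion fun p => {z ∈ A | G.Adj p z}) := by
    intro s
    have hs : s.map (.subtype _) ⊆ Q := by
      intro p hp
      obtain ⟨q, -, rfl⟩ := mem_map.1 hp
      exact q.2
    have := hcon (s.map (.subtype _)) (hs.trans hQP) (hQ ▸ card_le_card hs)
    rw [card_map] at this
    refine this.trans (card_le_card fun z hz => ?_)
    obtain ⟨hzA, p, hp, hpz⟩ := mem_filter.1 hz
    obtain ⟨q, hq, rfl⟩ := mem_map.1 hp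
    exact mem_biUnion.2 ⟨q, hq, mem_filter.2 ⟨hzA, hpz⟩⟩
  obtain ⟨φ, hφ, hφA⟩ := (all_card_le_biUnion_card_iff_exists_injective _).1 hall
  simp only [mem_filter] at hφA
  let e := (Q.equivFinOfCardEq hQ).symm
  refine ⟨fun i => (e i).1, fun i => φ (e i), Subtype.val_injective.comp e.injective,
    hφ.comp e.injective, fun i j hij => ?_, fun i => ⟨mem_union_left _ (hQP (e i).2),
      mem_union_right _ (hφA _).1, (hφA _).2⟩⟩
  have hij' : (e i).1 = φ (e j) := hij
  have hiP := hQP (e i).2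
  rw [hij'] at hiP
  exact disjoint_left.1 hPA hiP (hφA (e j)).1

theorem sum_le_card_of_incidence {V : Type*} [DecidableEq V] {K W : Finset V} {C : V → Finset V}
    {w b : V → ℕ} (hCW : ∀ u ∈ K, C u ⊆ W) (hC : ∀ u ∈ K, (C u).Nonempty)
    (hw : ∀ u ∈ K, ∀ y ∈ C u, w u * b y ≤ #(C u)) (hb : ∀ y ∈ W, #{u ∈ K | y ∈ C u} ≤ b y) :
    ∑ u ∈ K, w u ≤ #W := by
  have h₁ : ∀ u ∈ K, (w u : ℚ) ≤ ∑ y ∈ W, if y ∈ C u then (b y : ℚ)⁻¹ else 0 := by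
    intro u hu
    rw [← sum_filter, filter_mem_eq_inter, inter_eq_right.2 (hCW u hu)]
    have hpos : (0 : ℚ) < #(C u) := by exact_mod_cast (hC u hu).card_pos
    have hsum : (w u : ℚ) = ∑ _y ∈ C u, (w u : ℚ) / #(C u) := by
      rw [sum_const, nsmul_eq_mul]
      field_simp
    rw [hsum]
    refine sum_le_sum fun y hy => ?_
    have hby : (0 : ℚ) < b y := by
      have : 0 < #{u ∈ K | y ∈ C u} := card_pos.2 ⟨u, mem_filter.2 ⟨hu, hy⟩⟩
      exact_mod_cast this.trans_le (hb y (hCW u hu hy))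
    rw [div_le_iff₀ hpos, inv_mul_eq_div, le_div_iff₀ hby]
    exact_mod_cast hw u hu y hy
  have h₂ : ∀ y ∈ W, ∑ u ∈ K, (if y ∈ C u then (b y : ℚ)⁻¹ else 0) ≤ 1 := by
    intro y hy
    rw [← sum_filter, sum_const, nsmul_eq_mul]
    have : ((#{u ∈ K | y ∈ C u} : ℕ) : ℚ) ≤ b y := by exact_mod_cast hb y hy
    exact mul_inv_le_one_of_le₀ this (by positivity)
  have h₃ : ((∑ u ∈ K, w u : ℕ) : ℚ) ≤ #W := by
    push_cast
    calc ∑ u ∈ K, (w u : ℚ) ≤ ∑ u ∈ K, ∑ y ∈ W, if y ∈ C u then (b y : ℚ)⁻¹ else 0 := sum_le_sum h₁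
      _ = ∑ y ∈ W, ∑ u ∈ K, if y ∈ C u then (b y : ℚ)⁻¹ else 0 := sum_comm
      _ ≤ ∑ _y ∈ W, 1 := sum_le_sum h₂
      _ = #W := by simp
  exact_mod_cast h₃

/-- The neighbourhood of a vertex `u` of a large clique `K` contains a large set `C` of vertices
that are joined to most of `K` in the complement. -/
theorem exists_antiadjacent_of_mem_isClique {V : Type*} [Fintype V] [DecidableEq V]
    {G : SimpleGraph V} {n : ℕ} {K : Finset V} {u : V} (hG : ¬ HasMatching G (nbrs G u) n)
    (hdeg : 2 * n ≤ #(nbrs G u)) (hK : G.IsClique (K : Set V)) (hKn : n < #K) (hu : u ∈ K) :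
    ∃ (σ : ℕ) (C P : Finset V), C ⊆ nbrs G u ∧ Disjoint C K ∧ P ⊆ K ∧ #K ≤ #P + σ ∧
      #(nbrs G u) + σ ≤ #C + 2 * n ∧ (∀ y ∈ C, ∀ p ∈ P, Gᶜ.Adj y p) ∧
      (∀ y ∈ C, #(nbrs G u) + σ ≤ #(C ∩ nbrs Gᶜ y) + 2 * n + 1) ∧
      ∀ Q ⊆ nbrs G u, Disjoint Q C → Disjoint Q K → #K + #Q + σ ≤ 2 * n + 1 := by
  obtain ⟨S, hS, f, hf, hcard⟩ := exists_labels_of_not_hasMatching G (nbrs G u) hdeg hG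
  set A := nbrs G u \ S with hA
  have hAS : #A + #S = #(nbrs G u) := card_sdiff_add_card_eq_card hS
  have himg : #(A.image f) ≤ #A := card_image_le
  have hKu : K.erase u ⊆ nbrs G u := fun x hx =>
    mem_nbrs.2 (hK hu (mem_of_mem_erase hx) (ne_of_mem_erase hx).symm)
  have hKe := card_erase_add_one hu
  have hPA : K.erase u \ S ⊆ A := sdiff_subset_sdiff hKu subset_rfl
  have hPcard := le_card_sdiff S (K.erase u)
  obtain ⟨p₀, hp₀⟩ : (K.erase u \ S).Nonempty := by
    rw [← card_pos]
    omega
  have hPl : ∀ p ∈ K.erase u \ S, f p = f p₀ := by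
    intro p hp
    by_cases hpp : p = p₀
    · rw [hpp]
    · exact hf p (hPA hp) p₀ (hPA hp₀) (hK (mem_of_mem_erase (mem_sdiff.1 hp).1)
        (mem_of_mem_erase (mem_sdiff.1 hp₀).1) hpp)
  have hcompl : ∀ a ∈ A, ∀ b ∈ A, f a ≠ f b → Gᶜ.Adj a b := fun a ha b hb hab =>
    (SimpleGraph.compl_adj _ _ _).2 ⟨fun h => hab (congrArg f h), fun h => hab (hf a ha b hb h)⟩
  have hCimg := card_image_le_card_filter_ne_add_one A f (f p₀)
  have hCcard := card_filter_add_card_filter_not (s := A) (fun y => f y = f p₀)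
  refine ⟨#S + 1, {x ∈ A | ¬ f x = f p₀}, K.erase u \ S, ?_, ?_, ?_, ?_, ?_, ?_, ?_, ?_⟩
  · exact (filter_subset _ _).trans sdiff_subset
  · refine disjoint_left.2 fun y hy hyK => (mem_filter.1 hy).2 (hPl y ?_)
    have hyA := mem_sdiff.1 (mem_filter.1 hy).1
    exact mem_sdiff.2 ⟨mem_erase.2 ⟨(mem_nbrs.1 hyA.1).ne', hyK⟩, hyA.2⟩
  · exact sdiff_subset.trans (erase_subset _ _)
  · omega
  · omega
  · intro y hy p hp
    refine hcompl y (mem_filter.1 hy).1 p (hPA hp) ?_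
    rw [hPl p hp]
    exact (mem_filter.1 hy).2
  · intro y hy
    have hsub : A.image f ⊆
        insert (f p₀) (insert (f y) (({x ∈ A | ¬ f x = f p₀} ∩ nbrs Gᶜ y).image f)) := by
      refine image_subset_iff.2 fun z hz => ?_
      by_cases h₁ : f z = f p₀
      · simp [h₁]
      by_cases h₂ : f z = f y
      · simp [h₂]
      refine mem_insert_of_mem (mem_insert_of_mem (mem_image_of_mem f (mem_inter.2
        ⟨mem_filter.2 ⟨hz, h₁⟩, mem_nbrs.2 (hcompl y (mem_filter.1 hy).1 z hz (Ne.symm h₂))⟩)))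
    have h₁ := card_le_card hsub
    have h₂ := card_insert_le (f p₀)
      (insert (f y) (({x ∈ A | ¬ f x = f p₀} ∩ nbrs Gᶜ y).image f))
    have h₃ := card_insert_le (f y) (({x ∈ A | ¬ f x = f p₀} ∩ nbrs Gᶜ y).image f)
    have h₄ : #(({x ∈ A | ¬ f x = f p₀} ∩ nbrs Gᶜ y).image f) ≤ _ := card_image_le
    omega
  · intro Q hQ hQC hQK
    have hsub : K.erase u ∪ Q ⊆ S ∪ {x ∈ A | f x = f p₀} := by
      intro x hx
      rw [mem_union, or_iff_not_imp_left]
      intro hxS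
      rcases mem_union.1 hx with hx | hx
      · have hxP := mem_sdiff.2 ⟨hx, hxS⟩
        exact mem_filter.2 ⟨hPA hxP, hPl x hxP⟩
      · have hxA : x ∈ A := mem_sdiff.2 ⟨hQ hx, hxS⟩
        refine mem_filter.2 ⟨hxA, ?_⟩
        by_contra hne
        exact disjoint_left.1 hQC hx (mem_filter.2 ⟨hxA, hne⟩)
    have h₁ := card_le_card hsub
    rw [card_union_of_disjoint (hQK.mono_right (erase_subset _ _)).symm] at h₁
    have h₂ := card_union_le S {x ∈ A | f x = f p₀}
    omega

theorem not_isClique_of_not_hasMatching {V : Type*} [Fintype V] {G : SimpleGraph V} {n : ℕ}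
    (hG : ∀ x, ¬ HasMatching G (nbrs G x) n) (hB : ∀ x, ¬ HasMatching Gᶜ (nbrs Gᶜ x) n)
    (hV : 11 * n + 12 ≤ 2 * Fintype.card V) {K : Finset V}
    (hKcard : #K + 4 * n + 2 = Fintype.card V) : ¬ G.IsClique (K : Set V) := by
  classical
  intro hK
  have hd : ∀ v, Fintype.card V ≤ #(nbrs G v) + 3 * n ∧ Fintype.card V ≤ #(nbrs Gᶜ v) + 3 * n := by
    intro v
    have h₁ := card_nbrs_lt hG hB v
    have h₂ := card_nbrs_lt hB (by simpa using hG) v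
    have := card_nbrs_add_card_nbrs_compl G v
    omega
  have hC : ∀ u ∈ K, _ := fun u hu => exists_antiadjacent_of_mem_isClique (hG u)
    (by have := (hd u).1; omega) hK (by omega) hu
  choose! σ C P hCu hCK hPK hPσ hCσ hCP hDσ hQσ using hC
  let b : V → ℕ := fun y => #{u ∈ K | G.Adj u y}
  have hbσ : ∀ u ∈ K, ∀ y ∈ C u, b y ≤ σ u := by
    intro u hu y hy
    have hdisj : Disjoint {u ∈ K | G.Adj u y} (P u) := disjoint_left.2 fun p hp hpP =>
      ((SimpleGraph.compl_adj _ _ _).1 (hCP u hu y hy p hpP)).2 (mem_filter.1 hp).2.symm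
    have := card_le_card (union_subset (filter_subset (fun p => G.Adj p y) K) (hPK u hu))
    rw [card_union_of_disjoint hdisj] at this
    have := hPσ u hu
    have hby : b y = #{u ∈ K | G.Adj u y} := rfl
    omega
  have hσ : ∀ u ∈ K, #K + σ u ≤ 2 * n + 1 := fun u hu => by
    simpa using hQσ u hu ∅ (empty_subset _) (disjoint_empty_left _) (disjoint_empty_left _)
  have hCcard : ∀ u ∈ K, Fintype.card V + σ u ≤ #(C u) + 5 * n := fun u hu => by
    have := hCσ u hu
    have := (hd u).1
    omega
  have hCne : ∀ u ∈ K, (C u).Nonempty := fun u hu => by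
    have := hCcard u hu
    rw [← card_pos]
    omega
  have hb : ∀ y, #{u ∈ K | y ∈ C u} ≤ b y := fun y => card_le_card fun u hu => by
    obtain ⟨hu, hy⟩ := mem_filter.1 hu
    exact mem_filter.2 ⟨hu, mem_nbrs.1 (hCu u hu hy)⟩
  have hKc := card_add_card_compl K
  by_cases hsmall : ∀ u ∈ K, ∀ y ∈ C u, 2 * b y + Fintype.card V ≤ 6 * n
  · have := sum_le_card_of_incidence (w := fun _ => 3) (W := Kᶜ) (b := b)
      (fun u hu y hy => mem_compl.2 (disjoint_left.1 (hCK u hu) hy)) hCne ?_ (fun y _ => hb y)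
    · rw [sum_const, smul_eq_mul] at this
      omega
    · intro u hu y hy
      have := hsmall u hu y hy
      have := hbσ u hu y hy
      have := hCcard u hu
      omega
  push Not at hsmall
  obtain ⟨u₀, hu₀, y, hy, hby⟩ := hsmall
  have hyK : y ∉ K := disjoint_left.1 (hCK u₀ hu₀) hy
  have hPy : P u₀ ⊆ nbrs Gᶜ y := fun p hp => mem_nbrs.2 (hCP u₀ hu₀ y hy p hp)
  obtain ⟨P₀, hP₀P, hP₀n, hP₀⟩ := exists_deficient_subset (G := Gᶜ) (P := P u₀)
    (A := nbrs Gᶜ y \ K) (n := n) (disjoint_sdiff.mono_left (hPK u₀ hu₀))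
    (by have := hPσ u₀ hu₀; have := hσ u₀ hu₀; omega)
    (fun h => hB y (h.mono (union_subset hPy sdiff_subset)))
  set A := nbrs Gᶜ y \ K
  set Y := {z ∈ A | ∃ p ∈ P₀, Gᶜ.Adj p z}
  have hP₀K : P₀ ⊆ K := hP₀P.trans (hPK u₀ hu₀)
  have hDY : C u₀ ∩ nbrs Gᶜ y ⊆ Y := by
    intro z hz
    obtain ⟨hzC, hzy⟩ := mem_inter.1 hz
    obtain ⟨p, hp⟩ : P₀.Nonempty := card_pos.1 (by omega)
    exact mem_filter.2 ⟨mem_sdiff.2 ⟨hzy, disjoint_left.1 (hCK u₀ hu₀) hzC⟩, p, hp,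
      (hCP u₀ hu₀ z hzC p (hP₀P hp)).symm⟩
  have hP₀card : Fintype.card V + σ u₀ ≤ #P₀ + 5 * n := by
    have := card_le_card hDY
    have := hDσ u₀ hu₀ y hy
    have := (hd u₀).1
    omega
  have hAcard : Fintype.card V + b y ≤ #A + #K + 3 * n := by
    have h₁ : nbrs Gᶜ y ⊆ A ∪ (K \ {u ∈ K | G.Adj u y}) := by
      intro z hz
      by_cases hzK : z ∈ K
      · refine mem_union_right _ (mem_sdiff.2 ⟨hzK, fun h => ?_⟩)
        exact ((SimpleGraph.compl_adj _ _ _).1 (mem_nbrs.1 hz)).2 (mem_filter.1 h).2.symm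
      · exact mem_union_left _ (mem_sdiff.2 ⟨hz, hzK⟩)
    have h₂ := (card_le_card h₁).trans (card_union_le _ _)
    have h₃ : #(K \ {u ∈ K | G.Adj u y}) + b y = #K :=
      card_sdiff_add_card_eq_card (filter_subset _ _)
    have := (hd y).2
    omega
  set Q := A \ Y
  have hQcard : b y + 3 ≤ #Q := by
    have : #A - #Y ≤ #Q := le_card_sdiff Y A
    omega
  have hQK : Disjoint Q K := disjoint_sdiff_self_left.mono_left sdiff_subset
  have hQP₀ : ∀ z ∈ Q, ∀ p ∈ P₀, G.Adj p z := by
    intro z hz p hp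
    obtain ⟨hzA, hzY⟩ := mem_sdiff.1 hz
    by_contra hpz
    refine hzY (mem_filter.2 ⟨hzA, p, hp, (SimpleGraph.compl_adj _ _ _).2 ⟨?_, hpz⟩⟩)
    rintro rfl
    exact disjoint_left.1 hQK hz (hP₀K hp)
  have hQC : ∀ u ∈ K, Disjoint Q (C u) := by
    intro u hu
    refine disjoint_left.2 fun z hz hzC => ?_
    have h₁ : #P₀ ≤ b z :=
      card_le_card fun p hp => mem_filter.2 ⟨hP₀K hp, hQP₀ z hz p hp⟩
    have h₂ := hbσ u hu z hzC
    have h₃ := hσ u hu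
    omega
  have hσP₀ : ∀ u ∈ P₀, #K + #Q + σ u ≤ 2 * n + 1 := fun u hu =>
    hQσ u (hP₀K hu) Q (fun z hz => mem_nbrs.2 (hQP₀ z hz u hu)) (hQC u (hP₀K hu)) hQK
  have hsum := sum_le_card_of_incidence (w := fun u => if u ∈ P₀ then 3 else 2) (W := Kᶜ \ Q)
    (b := b) (fun u hu z hz => mem_sdiff.2 ⟨mem_compl.2 (disjoint_left.1 (hCK u hu) hz),
      disjoint_right.1 (hQC u hu) hz⟩) hCne ?_ (fun z _ => hb z)
  · have hw : ∑ u ∈ K, (if u ∈ P₀ then 3 else 2) = 2 * #K + #P₀ := by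
      have : ∀ u ∈ K, (if u ∈ P₀ then 3 else 2) = 2 + if u ∈ P₀ then 1 else 0 := by
        intro u _
        split_ifs <;> rfl
      rw [sum_congr rfl this, sum_add_distrib, sum_const, smul_eq_mul, ← card_filter,
        filter_mem_eq_inter, inter_eq_right.2 hP₀K, mul_comm]
    have hW : #(Kᶜ \ Q) + #Q = #Kᶜ := card_sdiff_add_card_eq_card fun z hz =>
      mem_compl.2 (disjoint_left.1 hQK hz)
    have := hbσ u₀ hu₀ y hy
    omega
  · intro u hu z hz
    have h₁ := hbσ u hu z hz
    have h₂ := hCcard u hu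
    have h₃ := hσ u hu
    split_ifs with hP
    · have := hσP₀ u hP
      omega
    · omega

theorem hasMatching_nbrs_of_card {V : Type*} [Fintype V] (G : SimpleGraph V) {n : ℕ}
    (hV : 11 * n + 12 ≤ 2 * Fintype.card V) :
    (∃ v, HasMatching G (nbrs G v) n) ∨ ∃ v, HasMatching Gᶜ (nbrs Gᶜ v) n := by
  by_contra! ⟨hG, hB⟩
  have hG' : ∀ v, ¬ HasMatching Gᶜᶜ (nbrs Gᶜᶜ v) n := by simpa using hG
  obtain ⟨v⟩ : Nonempty V := Fintype.card_pos_iff.1 (by omega)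
  have hv := card_nbrs_add_card_nbrs_compl G v
  obtain ⟨K, hK, hKcard⟩ : ∃ K : Finset V, (G.IsClique (K : Set V) ∨ Gᶜ.IsClique (K : Set V)) ∧
      Fintype.card V ≤ #K + 4 * n + 2 := by
    rcases le_total #(nbrs Gᶜ v) #(nbrs G v) with h | h
    · obtain ⟨K, hK, hKcard⟩ := exists_isClique_of_card_nbrs hG hB (v := v) (by omega)
      exact ⟨K, hK, by omega⟩
    · obtain ⟨K, hK, hKcard⟩ := exists_isClique_of_card_nbrs hB hG' (v := v) (by omega)
      rw [compl_compl] at hK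
      exact ⟨K, hK.symm, by omega⟩
  obtain ⟨L, hLK, hL⟩ := exists_subset_card_eq (s := K) (n := Fintype.card V - (4 * n + 2)) (by omega)
  rcases hK with hK | hK
  · exact not_isClique_of_not_hasMatching hG hB hV (by omega) (hK.subset (coe_subset.2 hLK))
  · exact not_isClique_of_not_hasMatching hB hG' hV (by omega) (hK.subset (coe_subset.2 hLK))

/-- `r(F_n) ≤ 11n/2 + 6`: if `N ≥ 11n/2 + 6` (i.e. `2N ≥ 11n + 12`), then every
red-blue coloring of the edges of `K_N` (encoded by the red graph `G`, the blue
graph being its complement) contains a monochromatic copy of the fan `F_n`. -/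
theorem fan_ramsey_upper (n : ℕ) (hn : 0 < n) (N : ℕ) (hN : 11 * n + 12 ≤ 2 * N)
    (G : SimpleGraph (Fin N)) :
    Contains (fanGraph n) G ∨ Contains (fanGraph n) Gᶜ :=
  (hasMatching_nbrs_of_card G (by simpa using hN)).imp
    (fun ⟨_, h⟩ => contains_fanGraph_of_hasMatching h)
    (fun ⟨_, h⟩ => contains_fanGraph_of_hasMatching h)
end

section
/- For every positive integer n, the diagonal Ramsey number of the fan satisfies r(F_n) ≥ 9n/2 - 5. Equivalently: letting t be the largest even integer less than 3n/2, there exists a graph G on 3t vertices such that neither G nor its complement contains a copy of F_n, and consequently r(F_n) ≥ 3t + 1 ≥ 9n/2 - 5. -/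
/-- The center of a copy of `F_n`, together with its neighbors, makes up `2n + 1` vertices. -/
lemma not_contains_fanGraph_of_closedNbhd {β : Type*} {n : ℕ} {G : SimpleGraph β}
    (h : ∀ v, ∃ S : Finset β, v ∈ S ∧ S.card ≤ 2 * n ∧ ∀ w, G.Adj v w → w ∈ S) :
    ¬ Contains (fanGraph n) G := by
  rintro ⟨f, hf, hadj⟩
  obtain ⟨S, hvS, hcard, hS⟩ := h (f 0)
  have hle : (Finset.univ : Finset (Fin (2 * n + 1))).card ≤ S.card := by
    refine Finset.card_le_card_of_injOn f (fun a _ => ?_) hf.injOn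
    by_cases ha : a = 0
    · exact ha ▸ hvS
    · exact hS _ (hadj (by simp [fanGraph, Ne.symm ha]))
  rw [Finset.card_univ, Fintype.card_fin] at hle
  omega

/-- If fewer than `n` vertices cover all edges inside each neighborhood, there is no `F_n`. -/
lemma not_contains_fanGraph_of_cover {β : Type*} {n : ℕ} {G : SimpleGraph β}
    (h : ∀ v, ∃ S : Finset β, S.card < n ∧
      ∀ a b, G.Adj v a → G.Adj v b → G.Adj a b → a ∈ S ∨ b ∈ S) :
    ¬ Contains (fanGraph n) G := by
  rintro ⟨f, hf, hadj⟩
  obtain ⟨S, hcard, hS⟩ := h (f 0)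
  have hcenter : ∀ a : Fin (2 * n + 1), a.val ≠ 0 → (fanGraph n).Adj 0 a := by
    intro a ha
    rw [fanGraph, SimpleGraph.fromRel_adj]
    exact ⟨fun h => ha (by simp [← h]), Or.inl (Or.inl rfl)⟩
  have key : ∀ i : Fin n, ∃ a : Fin (2 * n + 1), (a.val - 1) / 2 = i.val ∧ f a ∈ S := by
    intro i
    have hi := i.isLt
    let a : Fin (2 * n + 1) := ⟨2 * i.val + 1, by omega⟩
    let b : Fin (2 * n + 1) := ⟨2 * i.val + 2, by omega⟩
    have h0a : (fanGraph n).Adj 0 a := hcenter a (by simp [a])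
    have h0b : (fanGraph n).Adj 0 b := hcenter b (by simp [b])
    have hab : (fanGraph n).Adj a b := by
      rw [fanGraph, SimpleGraph.fromRel_adj]
      refine ⟨by simp [a, b], Or.inl (Or.inr ?_)⟩
      exact ⟨by simp only [a]; omega, rfl⟩
    rcases hS _ _ (hadj h0a) (hadj h0b) (hadj hab) with h1 | h1
    · exact ⟨a, by simp only [a]; omega, h1⟩
    · exact ⟨b, by simp only [b]; omega, h1⟩
  choose g hg hgS using key
  have hle : (Finset.univ : Finset (Fin n)).card ≤ S.card := by
    refine Finset.card_le_card_of_injOn (fun i => f (g i)) (fun i _ => hgS i) ?_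
    intro i _ j _ hij
    have hgij : g i = g j := hf hij
    exact Fin.ext (by rw [← hg i, ← hg j, hgij])
  rw [Finset.card_univ, Fintype.card_fin] at hle
  omega

lemma Contains.of_comap {α β γ : Type*} {H : SimpleGraph α} {G : SimpleGraph γ} (e : β ↪ γ)
    (h : Contains H (G.comap e)) : Contains H G := by
  obtain ⟨f, hf, hadj⟩ := h
  exact ⟨e ∘ f, e.injective.comp hf, fun _ _ hab => hadj hab⟩

lemma Contains.of_compl_comap {α β γ : Type*} {H : SimpleGraph α} {G : SimpleGraph γ} (e : β ↪ γ)
    (h : Contains H (G.comap e)ᶜ) : Contains H Gᶜ := by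
  obtain ⟨f, hf, hadj⟩ := h
  refine ⟨e ∘ f, e.injective.comp hf, fun a b hab => ?_⟩
  have := hadj hab
  rw [SimpleGraph.compl_adj] at this ⊢
  exact ⟨fun h => this.1 (e.injective h), this.2⟩

/-- Vertices of the extremal graph: three parts, each split into two halves of size `m`. -/
abbrev FanVertex (m : ℕ) : Type := Fin 3 × Bool × ZMod m

namespace FanVertex

variable {m : ℕ}

/-- The other part to which a vertex sends all its edges. -/
def crossPart (v : FanVertex m) : Fin 3 := if v.2.1 then v.1 - 1 else v.1 + 1

lemma eq_or_eq_crossPart (v : FanVertex m) {j k : Fin 3} (hj : v.1 ≠ j) (hk : v.1 ≠ k)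
    (hjk : j ≠ k) : j = v.crossPart ∨ k = v.crossPart := by
  have key : ∀ (i j k : Fin 3) (b : Bool), i ≠ j → i ≠ k → j ≠ k →
      (j = if b then i - 1 else i + 1) ∨ (k = if b then i - 1 else i + 1) := by decide
  exact key _ _ _ _ hj hk hjk

variable [NeZero m]

/-- The neighbors of a vertex outside its own part. -/
def crossNbrs (d : ℕ) (v : FanVertex m) : Finset (FanVertex m) :=
  (Finset.univ.filter fun z : ZMod m => z.val < d).image fun z =>
    (v.crossPart, !v.2.1, if v.2.1 then v.2.2 - z else v.2.2 + z)

/-- The part with index `i`. -/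
def part (i : Fin 3) : Finset (FanVertex m) := {i} ×ˢ Finset.univ

lemma mem_part {i : Fin 3} {v : FanVertex m} : v ∈ part i ↔ v.1 = i := by
  rw [part, Finset.mem_product, Finset.mem_singleton]
  exact and_iff_left (Finset.mem_univ _)

lemma card_part (i : Fin 3) : (part i : Finset (FanVertex m)).card = 2 * m := by
  simp [part, ZMod.card]

lemma crossNbrs_subset_part (d : ℕ) (v : FanVertex m) : crossNbrs d v ⊆ part v.crossPart := by
  intro w hw
  obtain ⟨z, -, rfl⟩ := Finset.mem_image.1 hw
  exact mem_part.2 rfl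

lemma card_filter_val_lt {d : ℕ} (hd : d ≤ m) :
    (Finset.univ.filter fun z : ZMod m => z.val < d).card = d := by
  have himg : (Finset.univ.filter fun z : ZMod m => z.val < d).image ZMod.val
      = Finset.range d := by
    ext k
    simp only [Finset.mem_image, Finset.mem_filter, Finset.mem_univ, true_and, Finset.mem_range]
    refine ⟨fun ⟨z, hz, hk⟩ => hk ▸ hz, fun hk => ⟨(k : ZMod m), ?_, ?_⟩⟩ <;>
      rw [ZMod.val_cast_of_lt (hk.trans_le hd)]
    exact hk
  rw [← Finset.card_image_of_injective _ (ZMod.val_injective m), himg, Finset.card_range]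

lemma card_crossNbrs {d : ℕ} (hd : d ≤ m) (v : FanVertex m) : (crossNbrs d v).card = d := by
  rw [crossNbrs, Finset.card_image_of_injective, card_filter_val_lt hd]
  intro y z h
  have h2 := congrArg (fun w : FanVertex m => w.2.2) h
  rcases hb : v.2.1 <;> simpa [hb] using h2

lemma mem_crossNbrs_symm {d : ℕ} {v w : FanVertex m} (h : w ∈ crossNbrs d v) :
    v ∈ crossNbrs d w := by
  obtain ⟨z, hz, rfl⟩ := Finset.mem_image.1 h
  refine Finset.mem_image.2 ⟨z, hz, ?_⟩
  obtain ⟨i, b, x⟩ := v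
  cases b <;> simp [crossPart]

/-- Parts are cliques, and each vertex has `d` further neighbors, all in one other part. -/
def graph (m d : ℕ) [NeZero m] : SimpleGraph (FanVertex m) where
  Adj v w := v ≠ w ∧ (v.1 = w.1 ∨ w ∈ crossNbrs d v)
  symm := ⟨fun _ _ h => ⟨h.1.symm, h.2.imp Eq.symm mem_crossNbrs_symm⟩⟩
  loopless := ⟨fun _ h => h.1 rfl⟩

lemma not_contains_graph {n d : ℕ} (hd : d ≤ m) (h : 2 * m + d ≤ 2 * n) :
    ¬ Contains (fanGraph n) (graph m d) := by
  refine not_contains_fanGraph_of_closedNbhd fun v => ⟨part v.1 ∪ crossNbrs d v, ?_, ?_, ?_⟩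
  · exact Finset.mem_union_left _ (mem_part.2 rfl)
  · refine (Finset.card_union_le _ _).trans ?_
    rwa [card_part, card_crossNbrs hd]
  · intro w hw
    exact Finset.mem_union.2 (hw.2.imp (fun h => mem_part.2 h.symm) id)

lemma not_contains_compl_graph {n d : ℕ} (hd : d ≤ m) (h : 2 * m < n + d) :
    ¬ Contains (fanGraph n) (graph m d)ᶜ := by
  have hcompl : ∀ {v w : FanVertex m}, (graph m d)ᶜ.Adj v w → v.1 ≠ w.1 ∧ w ∉ crossNbrs d v := by
    intro v w hvw
    rw [SimpleGraph.compl_adj] at hvw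
    exact not_or.1 fun h => hvw.2 ⟨hvw.1, h⟩
  refine not_contains_fanGraph_of_cover fun v => ⟨part v.crossPart \ crossNbrs d v, ?_, ?_⟩
  · rw [Finset.card_sdiff_of_subset (crossNbrs_subset_part d v), card_part, card_crossNbrs hd]
    omega
  · intro a b hva hvb hab
    obtain ⟨ha, ha'⟩ := hcompl hva
    obtain ⟨hb, hb'⟩ := hcompl hvb
    exact (eq_or_eq_crossPart v ha hb (hcompl hab).1).imp
      (fun h => Finset.mem_sdiff.2 ⟨mem_part.2 h, ha'⟩)
      (fun h => Finset.mem_sdiff.2 ⟨mem_part.2 h, hb'⟩)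

end FanVertex

/-- A coloring of `K_N` without a monochromatic `F_n`, for `N ≤ 6m` and `m` slightly below
`3n/4`. -/
lemma exists_graph_not_contains_fanGraph {n m N : ℕ} (hm : 4 * m < 3 * n) (hN : N ≤ 6 * m) :
    ∃ G : SimpleGraph (Fin N), ¬ Contains (fanGraph n) G ∧ ¬ Contains (fanGraph n) Gᶜ := by
  rcases Nat.eq_zero_or_pos m with rfl | hpos
  · obtain rfl : N = 0 := by omega
    exact ⟨⊥, fun ⟨f, _⟩ => (f 0).elim0, fun ⟨f, _⟩ => (f 0).elim0⟩
  · have : NeZero m := ⟨hpos.ne'⟩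
    have hcard : Fintype.card (Fin N) ≤ Fintype.card (FanVertex m) := by
      simp only [Fintype.card_prod, Fintype.card_fin, Fintype.card_bool, ZMod.card]
      omega
    obtain ⟨e⟩ := Function.Embedding.nonempty_of_card_le hcard
    have hd : 2 * m + 1 - n ≤ m := by omega
    exact ⟨(FanVertex.graph m (2 * m + 1 - n)).comap e,
      fun h => FanVertex.not_contains_graph hd (by omega) (h.of_comap e),
      fun h => FanVertex.not_contains_compl_graph hd (by omega) (h.of_compl_comap e)⟩

/-- `r(F_n) ≥ 9n/2 - 5`: letting `t` be the largest even integer with `t < 3n/2`,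
there is a graph `G` on `3t` vertices such that neither `G` nor its complement
contains a copy of the fan `F_n`; moreover `3t + 1 ≥ 9n/2 - 5`, and consequently
for every `N < 9n/2 - 5` there is a red-blue coloring of the edges of `K_N`
(encoded by the red graph `G`, the blue graph being its complement) with no
monochromatic copy of `F_n`, i.e. `r(F_n) ≥ 9n/2 - 5`. -/
theorem fan_ramsey_lower (n : ℕ) (hn : 0 < n) (t : ℕ) (ht_even : Even t)
    (ht_lt : 2 * t < 3 * n) (ht_max : ∀ s : ℕ, Even s → 2 * s < 3 * n → s ≤ t) :
    (∃ G : SimpleGraph (Fin (3 * t)),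
        ¬ Contains (fanGraph n) G ∧ ¬ Contains (fanGraph n) Gᶜ) ∧
    9 * n ≤ 2 * (3 * t + 1) + 10 ∧
    (∀ N : ℕ, 2 * N + 10 < 9 * n →
      ∃ G : SimpleGraph (Fin N),
        ¬ Contains (fanGraph n) G ∧ ¬ Contains (fanGraph n) Gᶜ) := by
  obtain ⟨m, rfl⟩ := ht_even
  have hmax : 3 * n ≤ 2 * (m + m + 2) := by
    by_contra! hlt
    have := ht_max (m + m + 2) ⟨m + 1, by ring⟩ hlt
    omega
  exact ⟨exists_graph_not_contains_fanGraph (m := m) (by omega) (by omega), by omega,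
    fun N hN => exists_graph_not_contains_fanGraph (m := m) (by omega) (by omega)⟩
end

section
/- Let n be a positive integer and let G be a graph with vertex set V. Suppose G contains a clique V_0 with |V_0| ≥ 3n/2 + 1 such that every vertex v ∈ V_0 has at least n neighbors in V \ V_0. Then G or its complement ̄G contains a copy of the fan F_n whose center lies in V_0. -/
/-- `G` contains a copy of the fan `F n` with center `v`: there are `n` pairwise
disjoint edges (a matching on `2n` vertices) all of whose endpoints are
neighbors of `v`. -/
def HasFanAt {V : Type*} (G : SimpleGraph V) (n : ℕ) (v : V) : Prop :=
  ∃ M : G.Subgraph, M.IsMatching ∧ M.verts ⊆ G.neighborSet v ∧ M.verts.ncard = 2 * n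

namespace SimpleGraph

variable {V : Type*}

/-- The finset `W` is the vertex set of a matching of `G`. -/
def IsMatched (G : SimpleGraph V) (W : Finset V) : Prop :=
  ∃ M : G.Subgraph, M.IsMatching ∧ M.verts = ↑W

lemma isMatched_empty (G : SimpleGraph V) : G.IsMatched ∅ :=
  ⟨⊥, by intro v hv; simp at hv, by simp⟩

lemma IsMatched.union [DecidableEq V] {G : SimpleGraph V} {W W' : Finset V}
    (h : G.IsMatched W) (h' : G.IsMatched W') (hd : Disjoint W W') : G.IsMatched (W ∪ W') := by
  obtain ⟨M, hM, hW⟩ := h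
  obtain ⟨M', hM', hW'⟩ := h'
  refine ⟨M ⊔ M', hM.sup hM' ?_, by simp [hW, hW']⟩
  rw [hM.support_eq_verts, hM'.support_eq_verts, hW, hW']
  exact_mod_cast hd

lemma isMatched_pair [DecidableEq V] {G : SimpleGraph V} {x y : V} (h : G.Adj x y) :
    G.IsMatched {x, y} :=
  ⟨G.subgraphOfAdj h, Subgraph.IsMatching.subgraphOfAdj h, by simp⟩

lemma IsClique.exists_isMatched {G : SimpleGraph V} {T : Finset V} (h : G.IsClique ↑T) {k : ℕ}
    (hk : 2 * k ≤ T.card) : ∃ W ⊆ T, W.card = 2 * k ∧ G.IsMatched W := by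
  obtain ⟨W, hWT, hW⟩ := Finset.exists_subset_card_eq hk
  have hc : G.IsClique (W : Set V) := h.subset (by exact_mod_cast hWT)
  obtain ⟨M, hM, hm⟩ := (hc.even_iff_exists_isMatching W.finite_toSet).1 (by simp [hW])
  exact ⟨W, hWT, hW, M, hm, hM⟩

lemma isMatched_union_image [DecidableEq V] {G : SimpleGraph V} {C : Finset V} {g : V → V}
    (hg : Set.InjOn g C) (hadj : ∀ c ∈ C, G.Adj c (g c)) (hd : Disjoint C (C.image g)) :
    G.IsMatched (C ∪ C.image g) := by
  have hd' : Disjoint (C : Set V) (g '' C) := by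
    rw [← Finset.coe_image]
    exact_mod_cast hd
  obtain ⟨M, hM, hm⟩ := Subgraph.IsMatching.exists_of_disjoint_sets_of_equiv hd'
    (Equiv.Set.imageOfInjOn g _ hg) (G := G) fun v ↦ hadj v v.2
  exact ⟨M, hm, by simp [hM]⟩

/-- A maximal matching inside a finset leaves an independent set uncovered. -/
lemma exists_isMatched_forall_not_adj [DecidableEq V] (G : SimpleGraph V) (A : Finset V) :
    ∃ (a : ℕ) (W : Finset V), W ⊆ A ∧ W.card = 2 * a ∧ G.IsMatched W ∧
      ∀ x ∈ A \ W, ∀ y ∈ A \ W, ¬ G.Adj x y := by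
  induction A using Finset.strongInduction with
  | H A ih =>
    by_cases h : ∃ x ∈ A, ∃ y ∈ A, G.Adj x y
    · obtain ⟨x, hx, y, hy, hxy⟩ := h
      have hsub : ({x, y} : Finset V) ⊆ A := by grind
      obtain ⟨a, W, hWA, hW, hm, hind⟩ := ih (A \ {x, y}) (by
        refine Finset.sdiff_ssubset hsub ⟨x, by simp⟩)
      have hd : Disjoint ({x, y} : Finset V) W :=
        Finset.disjoint_of_subset_right hWA Finset.disjoint_sdiff
      refine ⟨a + 1, {x, y} ∪ W, ?_, ?_, (isMatched_pair hxy).union hm hd, ?_⟩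
      · exact Finset.union_subset hsub (hWA.trans Finset.sdiff_subset)
      · rw [Finset.card_union_of_disjoint hd, Finset.card_pair hxy.ne, hW]
        ring
      · rwa [← Finset.sup_eq_union, ← sdiff_sdiff_left]
    · push Not at h
      exact ⟨0, ∅, by simp, by simp, G.isMatched_empty, by simpa using h⟩

/-- The deficiency version of the Hall marriage theorem. -/
lemma exists_injOn_of_card_le_card_filter_add (R : V → V → Prop) [DecidableRel R] (A K : Finset V)
    (d : ℕ) (h : ∀ T ⊆ A, T.card ≤ (K.filter fun y ↦ ∃ t ∈ T, R t y).card + d) :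
    ∃ C ⊆ A, ∃ g : V → V, Set.InjOn g C ∧ (∀ c ∈ C, g c ∈ K ∧ R c (g c)) ∧
      A.card ≤ C.card + d := by
  classical
  let t : A → Finset (V ⊕ Fin d) := fun a ↦ (K.filter (R a)).disjSum Finset.univ
  obtain ⟨f, hf, hft⟩ := (Finset.all_card_le_biUnion_card_iff_exists_injective t).1 (by
    intro s
    rcases s.eq_empty_or_nonempty with rfl | ⟨a, ha⟩
    · simp
    have hs := h (s.image Subtype.val) (by
      intro x hx
      obtain ⟨y, -, rfl⟩ := Finset.mem_image.1 hx
      exact y.2)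
    rw [Finset.card_image_of_injective _ Subtype.val_injective] at hs
    refine hs.trans ?_
    have hst : (K.filter fun y ↦ ∃ x ∈ s.image Subtype.val, R x y).disjSum
        (Finset.univ : Finset (Fin d)) ⊆ s.biUnion t := by
      rintro (y | i) hy
      · obtain ⟨hyK, x, hx, hxy⟩ := Finset.mem_filter.1 (Finset.inl_mem_disjSum.1 hy)
        obtain ⟨x, hxs, rfl⟩ := Finset.mem_image.1 hx
        exact Finset.mem_biUnion.2
          ⟨x, hxs, Finset.inl_mem_disjSum.2 (Finset.mem_filter.2 ⟨hyK, hxy⟩)⟩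
      · exact Finset.mem_biUnion.2 ⟨a, ha, Finset.inr_mem_disjSum.2 (Finset.mem_univ i)⟩
    simpa only [Finset.card_disjSum, Finset.card_univ, Fintype.card_fin]
      using Finset.card_le_card hst)
  let g : V → V := fun v ↦ if hv : v ∈ A then (f ⟨v, hv⟩).elim id (fun _ ↦ v) else v
  let C : Finset V := A.filter fun v ↦ ∃ hv : v ∈ A, (f ⟨v, hv⟩).isLeft
  have key : ∀ c ∈ C, ∃ hc : c ∈ A, f ⟨c, hc⟩ = Sum.inl (g c) := by
    intro c hc
    obtain ⟨hcA, _, hl⟩ := Finset.mem_filter.1 hc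
    obtain ⟨y, hy⟩ := Sum.isLeft_iff.1 hl
    exact ⟨hcA, by simp [g, hcA, hy]⟩
  refine ⟨C, Finset.filter_subset _ _, g, ?_, ?_, ?_⟩
  · intro x hx y hy hxy
    obtain ⟨hxA, hx⟩ := key x hx
    obtain ⟨hyA, hy⟩ := key y hy
    simpa using hf (hx.trans ((congrArg Sum.inl hxy).trans hy.symm))
  · intro c hc
    obtain ⟨hcA, hc⟩ := key c hc
    have := hft ⟨c, hcA⟩
    rw [hc] at this
    simpa [t] using this
  · have hr : (A \ C).card ≤ d := by
      have hmap : ∀ v ∈ A \ C, ∃ i : Fin d, ∃ hv : v ∈ A, f ⟨v, hv⟩ = Sum.inr i := by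
        intro v hv
        obtain ⟨hvA, hvC⟩ := Finset.mem_sdiff.1 hv
        cases hfv : f ⟨v, hvA⟩ with
        | inl y => exact absurd (Finset.mem_filter.2 ⟨hvA, hvA, by simp [hfv]⟩) hvC
        | inr i => exact ⟨i, hvA, hfv⟩
      choose j hj using hmap
      have := Finset.card_le_card_of_injective (s := A \ C) (t := (Finset.univ : Finset (Fin d)))
        (f := fun x ↦ ⟨j x x.2, Finset.mem_univ _⟩) (by
        rintro ⟨x, hx⟩ ⟨y, hy⟩ hxy
        have hxy : j x hx = j y hy := congrArg Subtype.val hxy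
        obtain ⟨hxA, hx⟩ := hj x hx
        obtain ⟨hyA, hy⟩ := hj y hy
        simpa using hf (hx.trans ((congrArg Sum.inr hxy).trans hy.symm)))
      simpa using this
    have := Finset.card_le_card_sdiff_add_card (s := A) (t := C)
    omega

/-- A clique `K` with at least `n` vertices and a disjoint set `A` of `n` vertices either span a
matching with `n` edges, or `A` contains a large independent set with few neighbors in `K`. -/
lemma IsClique.exists_isMatched_or_exists_independent [DecidableEq V] {G : SimpleGraph V} {n : ℕ}
    {A K : Finset V} (hK : G.IsClique ↑K) (hA : A.card = n) (hn : n ≤ K.card)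
    (hd : Disjoint A K) :
    (∃ W ⊆ A ∪ K, W.card = 2 * n ∧ G.IsMatched W) ∨
    (∃ T ⊆ A, ∃ X ⊆ K, (∀ x ∈ T, ∀ y ∈ T, ¬ G.Adj x y) ∧ (∀ w ∈ K \ X, ∀ t ∈ T, ¬ G.Adj w t) ∧
      X.card + K.card + 1 ≤ T.card + n) := by
  classical
  rw [or_iff_not_imp_right]
  intro hT
  obtain ⟨a, W, hWA, hW, hWm, hind⟩ := G.exists_isMatched_forall_not_adj A
  obtain ⟨C, hCA, g, hg, hgK, hC⟩ := exists_injOn_of_card_le_card_filter_add G.Adj (A \ W) K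
    (K.card - n) (by
      intro T hTA
      by_contra! hlt
      refine hT ⟨T, hTA.trans Finset.sdiff_subset, K.filter fun y ↦ ∃ t ∈ T, G.Adj t y,
        Finset.filter_subset _ _, fun x hx y hy ↦ hind x (hTA hx) y (hTA hy), ?_, by omega⟩
      intro w hw t ht hwt
      simp only [Finset.mem_sdiff, Finset.mem_filter, not_and, not_exists] at hw
      exact hw.2 hw.1 t ht hwt.symm)
  have hWle := Finset.card_le_card hWA
  rw [Finset.card_sdiff_of_subset hWA] at hC
  obtain ⟨C', hC'C, hC'⟩ := Finset.exists_subset_card_eq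
    (show 2 * n - K.card - 2 * a ≤ C.card by omega)
  have hg' : Set.InjOn g C' := hg.mono (by exact_mod_cast hC'C)
  have hI : C'.image g ⊆ K := by
    intro y hy
    obtain ⟨c, hc, rfl⟩ := Finset.mem_image.1 hy
    exact (hgK c (hC'C hc)).1
  have hIc : (C'.image g).card = C'.card := Finset.card_image_of_injOn hg'
  have hC'A : C' ⊆ A \ W := hC'C.trans hCA
  have hC'd : Disjoint C' (C'.image g) :=
    Finset.disjoint_of_subset_left (hC'A.trans Finset.sdiff_subset)
      (Finset.disjoint_of_subset_right hI hd)
  have hKc : (K \ C'.image g).card = K.card - C'.card := by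
    rw [Finset.card_sdiff_of_subset hI, hIc]
  obtain ⟨L, hLK, hL, hLm⟩ := IsClique.exists_isMatched (G := G) (T := K \ C'.image g)
    (hK.subset (by exact_mod_cast Finset.sdiff_subset))
    (k := n - a - (2 * n - K.card - 2 * a)) (by omega)
  have hCm := isMatched_union_image hg' (fun c hc ↦ (hgK c (hC'C hc)).2) hC'd
  have hd1 : Disjoint W (C' ∪ C'.image g) := by
    rw [Finset.disjoint_left] at *
    grind
  have hd2 : Disjoint (W ∪ (C' ∪ C'.image g)) L := by
    rw [Finset.disjoint_left] at *
    grind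
  refine ⟨_, ?_, ?_, (hWm.union hCm hd1).union hLm hd2⟩
  · grind
  · rw [Finset.card_union_of_disjoint hd2, Finset.card_union_of_disjoint hd1,
      Finset.card_union_of_disjoint hC'd, hIc, hW, hL, hC']
    omega

lemma IsMatched.hasFanAt {G : SimpleGraph V} {W : Finset V} {n : ℕ} {v : V} (h : G.IsMatched W)
    (hW : W.card = 2 * n) (hadj : ∀ x ∈ W, G.Adj v x) : HasFanAt G n v := by
  obtain ⟨M, hM, hv⟩ := h
  refine ⟨M, hM, ?_, by simp [hv, hW]⟩
  rw [hv]
  intro x hx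
  exact hadj x (by simpa using hx)

lemma hasFanAt_of_isClique_of_isClique [DecidableEq V] {G : SimpleGraph V} {n : ℕ} {w : V}
    {T₁ T₂ T₃ T₄ : Finset V}
    (h₁ : G.IsClique ↑T₁) (h₂ : G.IsClique ↑T₂) (h₃ : G.IsClique ↑T₃) (h₄ : G.IsClique ↑T₄)
    (h₁₂ : Disjoint T₁ T₂) (h₁₃ : Disjoint T₁ T₃) (h₁₄ : Disjoint T₁ T₄)
    (h₂₃ : Disjoint T₂ T₃) (h₂₄ : Disjoint T₂ T₄) (h₃₄ : Disjoint T₃ T₄)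
    (hadj : ∀ x ∈ T₁ ∪ T₂ ∪ T₃ ∪ T₄, G.Adj w x)
    (hn : n ≤ T₁.card / 2 + T₂.card / 2 + T₃.card / 2 + T₄.card / 2) : HasFanAt G n w := by
  obtain ⟨t₁, t₂, t₃, t₄, ht₁, ht₂, ht₃, ht₄, hsum⟩ : ∃ t₁ t₂ t₃ t₄ : ℕ, 2 * t₁ ≤ T₁.card ∧
      2 * t₂ ≤ T₂.card ∧ 2 * t₃ ≤ T₃.card ∧ 2 * t₄ ≤ T₄.card ∧ t₁ + t₂ + t₃ + t₄ = n := by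
    refine ⟨min (T₁.card / 2) n, min (T₂.card / 2) (n - T₁.card / 2),
      min (T₃.card / 2) (n - T₁.card / 2 - T₂.card / 2),
      n - T₁.card / 2 - T₂.card / 2 - T₃.card / 2, ?_, ?_, ?_, ?_, ?_⟩ <;> omega
  obtain ⟨W₁, hs₁, hc₁, hm₁⟩ := h₁.exists_isMatched ht₁
  obtain ⟨W₂, hs₂, hc₂, hm₂⟩ := h₂.exists_isMatched ht₂
  obtain ⟨W₃, hs₃, hc₃, hm₃⟩ := h₃.exists_isMatched ht₃
  obtain ⟨W₄, hs₄, hc₄, hm₄⟩ := h₄.exists_isMatched ht₄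
  have d₁ : Disjoint W₁ W₂ := Finset.disjoint_of_subset_left hs₁
    (Finset.disjoint_of_subset_right hs₂ h₁₂)
  have d₂ : Disjoint (W₁ ∪ W₂) W₃ := Finset.disjoint_of_subset_left
    (Finset.union_subset_union hs₁ hs₂)
    (Finset.disjoint_of_subset_right hs₃ (Finset.disjoint_union_left.2 ⟨h₁₃, h₂₃⟩))
  have d₃ : Disjoint (W₁ ∪ W₂ ∪ W₃) W₄ := Finset.disjoint_of_subset_left
    (Finset.union_subset_union (Finset.union_subset_union hs₁ hs₂) hs₃)
    (Finset.disjoint_of_subset_right hs₄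
      (Finset.disjoint_union_left.2 ⟨Finset.disjoint_union_left.2 ⟨h₁₄, h₂₄⟩, h₃₄⟩))
  refine (((hm₁.union hm₂ d₁).union hm₃ d₂).union hm₄ d₃).hasFanAt ?_ fun x hx ↦ hadj x ?_
  · rw [Finset.card_union_of_disjoint d₃, Finset.card_union_of_disjoint d₂,
      Finset.card_union_of_disjoint d₁]
    omega
  · exact Finset.union_subset_union (Finset.union_subset_union
      (Finset.union_subset_union hs₁ hs₂) hs₃) hs₄ hx

/-- A vertex `u` of the clique `V₀` that is not the center of a fan has a large set `T` of outside
neighbors which is independent and has no neighbors in `V₀` outside a small set `B`. -/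
lemma exists_independent_of_not_hasFanAt [Fintype V] {n : ℕ} {G : SimpleGraph V} {V₀ : Finset V}
    (hclique : G.IsClique ↑V₀) (hcard : n + 1 ≤ V₀.card) {u : V} (hu : u ∈ V₀)
    (hdeg : n ≤ (G.neighborSet u \ ↑V₀).ncard) (hfan : ¬ HasFanAt G n u) :
    ∃ T B : Finset V, (∀ t ∈ T, G.Adj u t ∧ t ∉ V₀) ∧ Gᶜ.IsClique ↑T ∧
      (∀ w ∈ V₀, w ∉ B → ∀ t ∈ T, ¬ G.Adj w t) ∧
      0 < B.card ∧ B.card + V₀.card ≤ T.card + n + 1 ∧ T.card ≤ n := by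
  classical
  rw [Set.ncard_eq_toFinset_card'] at hdeg
  obtain ⟨A, hAs, hA⟩ := Finset.exists_subset_card_eq hdeg
  have hAadj : ∀ x ∈ A, G.Adj u x ∧ x ∉ V₀ := fun x hx ↦ by simpa using hAs hx
  have hKc := Finset.card_erase_of_mem hu
  have hd : Disjoint A (V₀.erase u) := by
    rw [Finset.disjoint_left]
    exact fun x hx hx' ↦ (hAadj x hx).2 (Finset.mem_of_mem_erase hx')
  rcases IsClique.exists_isMatched_or_exists_independent (G := G) (K := V₀.erase u)
    (hclique.subset (by simp)) hA (by omega) hd with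
    ⟨W, hWs, hW, hm⟩ | ⟨T, hTA, X, hX, hind, hnon, hTc⟩
  · refine absurd (hm.hasFanAt hW fun x hx ↦ ?_) hfan
    rcases Finset.mem_union.1 (hWs hx) with h | h
    · exact (hAadj x h).1
    · obtain ⟨hne, hx⟩ := Finset.mem_erase.1 h
      exact hclique hu hx hne.symm
  · refine ⟨T, insert u X, fun t ht ↦ hAadj t (hTA ht), ?_, ?_,
      Finset.card_pos.2 (Finset.insert_nonempty u X), ?_, ?_⟩
    · intro x hx y hy hne
      exact (compl_adj _ _ _).2 ⟨hne, hind x hx y hy⟩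
    · intro w hw hwB
      rw [Finset.mem_insert, not_or] at hwB
      exact hnon w (by simp [hwB, hw])
    · have := Finset.card_insert_le u X
      omega
    · exact hA ▸ Finset.card_le_card hTA

end SimpleGraph

/-- If a graph `G` contains a clique `V₀` with `|V₀| ≥ 3n/2 + 1` such that every
vertex of `V₀` has at least `n` neighbors outside `V₀`, then `G` or its
complement contains a copy of the fan `F_n` with center in `V₀`. -/
theorem fan_lemma {V : Type*} [Fintype V] (n : ℕ) (hn : 0 < n)
    (G : SimpleGraph V) (V₀ : Finset V)
    (hclique : G.IsClique ↑V₀)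
    (hcard : 3 * n + 2 ≤ 2 * V₀.card)
    (hdeg : ∀ v ∈ V₀, n ≤ (G.neighborSet v \ ↑V₀).ncard) :
    (∃ v ∈ V₀, HasFanAt G n v) ∨ (∃ v ∈ V₀, HasFanAt Gᶜ n v) := by
  classical
  rw [or_iff_not_imp_left]
  intro hno
  push Not at hno
  have hex := fun (u : V) (hu : u ∈ V₀) ↦ SimpleGraph.exists_independent_of_not_hasFanAt hclique
    (show n + 1 ≤ V₀.card by omega) hu (hdeg u hu) (hno u hu)
  choose! T B hadj hind hnon hB hTB hTn using hex
  have hdisj : ∀ u ∈ V₀, ∀ v ∈ V₀, v ∉ B u → Disjoint (T u) (T v) := by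
    intro u hu v hv hvB
    rw [Finset.disjoint_left]
    exact fun t ht ht' ↦ hnon u hu v hv hvB t ht (hadj v hv t ht').1
  have hpick : ∀ S : Finset V, S.card < V₀.card → ∃ w ∈ V₀, w ∉ S := fun S hS ↦
    Finset.exists_mem_notMem_of_card_lt_card hS
  have hcompl : ∀ u ∈ V₀, ∀ w ∈ V₀, w ∉ B u → ∀ t ∈ T u, Gᶜ.Adj w t := by
    intro u hu w hw hwB t ht
    refine (SimpleGraph.compl_adj _ _ _).2 ⟨?_, hnon u hu w hw hwB t ht⟩
    rintro rfl
    exact (hadj u hu w ht).2 hw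
  obtain ⟨u₁, h₁, -⟩ := hpick ∅ (by rw [Finset.card_empty]; omega)
  have hp₁ := hB u₁ h₁
  have hb₁ := hTB u₁ h₁
  have hn₁ := hTn u₁ h₁
  obtain ⟨u₂, h₂, hu₂⟩ := hpick (B u₁) (by omega)
  have hp₂ := hB u₂ h₂
  have hb₂ := hTB u₂ h₂
  have hn₂ := hTn u₂ h₂
  have hU₂ := Finset.card_union_le (B u₁) (B u₂)
  obtain ⟨u₃, h₃, hu₃⟩ := hpick (B u₁ ∪ B u₂) (by omega)
  have hp₃ := hB u₃ h₃
  have hb₃ := hTB u₃ h₃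
  have hn₃ := hTn u₃ h₃
  have hU₃ := Finset.card_union_le (B u₁ ∪ B u₂) (B u₃)
  obtain ⟨u₄, h₄, hu₄⟩ := hpick (B u₁ ∪ B u₂ ∪ B u₃) (by omega)
  have hp₄ := hB u₄ h₄
  have hb₄ := hTB u₄ h₄
  have hn₄ := hTn u₄ h₄
  have hU₄ := Finset.card_union_le (B u₁ ∪ B u₂ ∪ B u₃) (B u₄)
  simp only [Finset.mem_union, not_or] at hu₃ hu₄
  have d₁₂ := hdisj u₁ h₁ u₂ h₂ hu₂
  have d₁₃ := hdisj u₁ h₁ u₃ h₃ hu₃.1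
  have d₂₃ := hdisj u₂ h₂ u₃ h₃ hu₃.2
  by_cases hsum : n ≤ (T u₁).card / 2 + (T u₂).card / 2 + (T u₃).card / 2
  · refine ⟨u₄, h₄, SimpleGraph.hasFanAt_of_isClique_of_isClique (T₄ := ∅)
      (hind u₁ h₁) (hind u₂ h₂) (hind u₃ h₃) (by simp) d₁₂ d₁₃ (by simp) d₂₃ (by simp) (by simp)
      ?_ (by simpa using hsum)⟩
    intro x hx
    simp only [Finset.mem_union, Finset.notMem_empty, or_false] at hx
    rcases hx with (hx | hx) | hx
    · exact hcompl u₁ h₁ u₄ h₄ hu₄.1.1 x hx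
    · exact hcompl u₂ h₂ u₄ h₄ hu₄.1.2 x hx
    · exact hcompl u₃ h₃ u₄ h₄ hu₄.2 x hx
  · obtain ⟨w, hw, hwB⟩ := hpick (B u₁ ∪ B u₂ ∪ B u₃ ∪ B u₄) (by omega)
    simp only [Finset.mem_union, not_or] at hwB
    refine ⟨w, hw, SimpleGraph.hasFanAt_of_isClique_of_isClique
      (hind u₁ h₁) (hind u₂ h₂) (hind u₃ h₃) (hind u₄ h₄) d₁₂ d₁₃ (hdisj u₁ h₁ u₄ h₄ hu₄.1.1)
      d₂₃ (hdisj u₂ h₂ u₄ h₄ hu₄.1.2) (hdisj u₃ h₃ u₄ h₄ hu₄.2) ?_ (by omega)⟩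
    intro x hx
    simp only [Finset.mem_union] at hx
    rcases hx with ((hx | hx) | hx) | hx
    · exact hcompl u₁ h₁ w hw hwB.1.1.1 x hx
    · exact hcompl u₂ h₂ w hw hwB.1.1.2 x hx
    · exact hcompl u₃ h₃ w hw hwB.1.2 x hx
    · exact hcompl u₄ h₄ w hw hwB.2 x hx
end

section
/- Let n be a positive integer and let G be a graph whose maximum degree Δ(G) satisfies Δ(G) ≥ 3n. Then G or its complement ̄G contains a copy of the fan F_n. -/
open Finset

/-- A vertex joined to both ends of each of `n` disjoint edges is the center of a copy of `F_n`. -/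
theorem contains_fanGraph {V ι : Type*} [Fintype ι] {n : ℕ} (hι : Fintype.card ι = n)
    {G : SimpleGraph V} (u : V) (a b : ι → V) (hinj : Function.Injective (Sum.elim a b))
    (ha : ∀ i, G.Adj u (a i)) (hb : ∀ i, G.Adj u (b i)) (hab : ∀ i, G.Adj (a i) (b i)) :
    Contains (fanGraph n) G := by
  have e : Fin n ≃ ι := (Fintype.equivFinOfCardEq hι).symm
  obtain ⟨haa, hbb, hne⟩ := Sum.elim_injective.1 hinj
  let f : Fin (2 * n + 1) → V := fun k =>
    if h : k.val = 0 then u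
    else if k.val % 2 = 1 then a (e ⟨(k.val - 1) / 2, by omega⟩)
    else b (e ⟨(k.val - 1) / 2, by omega⟩)
  have hadj : ∀ k l : Fin (2 * n + 1), k ≠ l →
      (k.val = 0 ∨ (k.val % 2 = 1 ∧ l.val = k.val + 1)) → G.Adj (f k) (f l) := by
    rintro ⟨k, hk⟩ ⟨l, hl⟩ hkl h
    simp only [ne_eq, Fin.mk.injEq] at hkl h
    rcases h with rfl | ⟨h1, rfl⟩
    · have : l ≠ 0 := by omega
      simp only [f, this, dite_true, dite_false]
      split_ifs
      · exact ha _
      · exact hb _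
    · have h0 : k ≠ 0 := by omega
      have h2 : (k + 1) % 2 ≠ 1 := by omega
      have h3 : (k + 1 - 1) / 2 = (k - 1) / 2 := by omega
      simp only [f, h0, h1, h2, h3, dite_false, if_true, if_false, Nat.add_eq_zero_iff,
        one_ne_zero, and_false]
      exact hab _
  refine ⟨f, ?_, fun k l h => ?_⟩
  · rintro ⟨k, hk⟩ ⟨l, hl⟩ h
    simp only [f] at h
    rw [Fin.mk.injEq]
    split_ifs at h with h1 h2 h3 h4 h5 h6 h7 h8
    · omega
    · exact absurd h (ha _).ne
    · exact absurd h (hb _).ne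
    · exact absurd h.symm (ha _).ne
    · have := congrArg Fin.val (e.injective (haa h))
      simp only at this
      omega
    · exact absurd h (hne _ _)
    · exact absurd h.symm (hb _).ne
    · exact absurd h.symm (hne _ _)
    · have := congrArg Fin.val (e.injective (hbb h))
      simp only at this
      omega
  · rw [fanGraph, SimpleGraph.fromRel_adj] at h
    obtain ⟨hne, h | h⟩ := h
    · exact hadj k l hne h
    · exact (hadj l k hne.symm h).symm

/-- `S` contains `k` pairwise disjoint edges of `G`. -/
def HasMatchingIn {V : Type*} (G : SimpleGraph V) (S : Set V) (k : ℕ) : Prop :=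
  ∃ a b : Fin k → V, Function.Injective (Sum.elim a b) ∧
    (∀ i, a i ∈ S) ∧ (∀ i, b i ∈ S) ∧ ∀ i, G.Adj (a i) (b i)

theorem HasMatchingIn.cons {V : Type*} {G : SimpleGraph V} {S : Set V} {k : ℕ} {a b : Fin k → V}
    (hinj : Function.Injective (Sum.elim a b)) (ha : ∀ i, a i ∈ S) (hb : ∀ i, b i ∈ S)
    (hab : ∀ i, G.Adj (a i) (b i)) {x y : V} (hx : x ∈ S) (hy : y ∈ S) (hxy : G.Adj x y)
    (hx' : x ∉ Set.range (Sum.elim a b)) (hy' : y ∉ Set.range (Sum.elim a b)) :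
    HasMatchingIn G S (k + 1) := by
  rw [Set.Sum.elim_range, Set.mem_union, not_or] at hx' hy'
  obtain ⟨h1, h2, h3⟩ := Sum.elim_injective.1 hinj
  refine ⟨Fin.cons x a, Fin.cons y b, ?_, Fin.cases hx ha, Fin.cases hy hb, Fin.cases hxy hab⟩
  refine Function.Injective.sumElim (Fin.cons_injective_iff.2 ⟨hx'.1, h1⟩)
    (Fin.cons_injective_iff.2 ⟨hy'.2, h2⟩) ?_
  refine Fin.cases (Fin.cases hxy.ne fun j h => ?_) fun i => Fin.cases (fun h => ?_) fun j => h3 i j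
  · exact hx'.2 ⟨j, h.symm⟩
  · exact hy'.1 ⟨i, h⟩

/-- An augmenting path of length three enlarges a matching. -/
theorem HasMatchingIn.augment {V : Type*} {G : SimpleGraph V} {S : Set V} {k : ℕ}
    {a b : Fin k → V}
    (hinj : Function.Injective (Sum.elim a b)) (ha : ∀ i, a i ∈ S) (hb : ∀ i, b i ∈ S)
    (hab : ∀ i, G.Adj (a i) (b i)) {x y : V} (hx : x ∈ S) (hy : y ∈ S) (hxy : x ≠ y)
    (hx' : x ∉ Set.range (Sum.elim a b)) (hy' : y ∉ Set.range (Sum.elim a b))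
    (e : Fin k) (hax : G.Adj (a e) x) (hby : G.Adj (b e) y) :
    HasMatchingIn G S (k + 1) := by
  simp only [Set.mem_range, Sum.exists, Sum.elim_inl, Sum.elim_inr, not_or, not_exists] at hx' hy'
  obtain ⟨haa, hbb, hne⟩ := Sum.elim_injective.1 hinj
  refine HasMatchingIn.cons (a := a) (b := Function.update b e x) (x := b e) (y := y)
    (haa.sumElim (fun i j h => ?_) fun i j => ?_) ha (fun i => ?_) (fun i => ?_)
    (hb e) hy hby ?_ ?_
  all_goals
    simp only [Set.mem_range, Sum.exists, Sum.elim_inl, Sum.elim_inr, not_or, not_exists,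
      Function.update_apply] at *
    grind

/-- If the complement of `G` contains no `F_n`, then any `3n` vertices span `n` disjoint edges. -/
theorem contains_fanGraph_compl_of_not_hasMatchingIn {V : Type*} {n : ℕ} {G : SimpleGraph V}
    {S : Finset V} (hS : 3 * n ≤ #S) (hn : ¬ HasMatchingIn G S n) :
    Contains (fanGraph n) Gᶜ := by
  classical
  obtain ⟨m, hmn, ⟨a, b, hinj, ha, hb, hab⟩, hmax⟩ :
      ∃ m < n, HasMatchingIn G S m ∧ ¬ HasMatchingIn G S (m + 1) := by
    by_contra! hstep
    have : ∀ k ≤ n, HasMatchingIn G S k := by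
      intro k
      induction k with
      | zero =>
        exact fun _ => ⟨Fin.elim0, Fin.elim0, fun i => by rcases i with i | i <;> exact i.elim0,
          fun i => i.elim0, fun i => i.elim0, fun i => i.elim0⟩
      | succ k ih => exact fun hk => hstep k hk (ih (by omega))
    exact hn (this n le_rfl)
  set I := S \ univ.image (Sum.elim a b) with hI
  have hIcard : 3 * n ≤ #I + 2 * m := by
    have h1 := le_card_sdiff (univ.image (Sum.elim a b)) S
    have h2 : #(univ.image (Sum.elim a b)) = 2 * m := by
      rw [card_image_of_injective _ hinj, card_univ, Fintype.card_sum, Fintype.card_fin]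
      ring
    rw [← hI] at h1
    omega
  have hmemI : ∀ x ∈ I, x ∈ (S : Set V) ∧ x ∉ Set.range (Sum.elim a b) := fun x hx => by
    simpa [hI] using hx
  have hindep : ∀ x ∈ I, ∀ y ∈ I, ¬ G.Adj x y := fun x hx y hy hxy =>
    hmax (.cons hinj ha hb hab (hmemI x hx).1 (hmemI y hy).1 hxy (hmemI x hx).2 (hmemI y hy).2)
  have hend : ∀ e, ∃ y c : V, (y = a e ∨ y = b e) ∧ ∀ x ∈ I, G.Adj y x → x = c := by
    intro e
    by_cases hae : ∃ x ∈ I, ∃ y ∈ I, x ≠ y ∧ G.Adj (a e) x ∧ G.Adj (a e) y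
    · obtain ⟨x, hx, y, hy, hxy, hax, hay⟩ := hae
      refine ⟨b e, x, .inr rfl, fun z hz hbz => ?_⟩
      by_contra hzx
      exact hmax (.augment hinj ha hb hab (hmemI x hx).1 (hmemI z hz).1 (Ne.symm hzx)
        (hmemI x hx).2 (hmemI z hz).2 e hax hbz)
    · push Not at hae
      by_cases hx : ∃ x ∈ I, G.Adj (a e) x
      · obtain ⟨x, hx, hax⟩ := hx
        exact ⟨a e, x, .inl rfl, fun z hz haz => by_contra fun hzx => hae z hz x hx hzx haz hax⟩
      · exact ⟨a e, a e, .inl rfl, fun z hz haz => absurd ⟨z, hz, haz⟩ hx⟩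
  choose y c hy hyc using hend
  obtain ⟨haa, hbb, hab'⟩ := Sum.elim_injective.1 hinj
  have hyinj : Function.Injective y := fun i j hij => by
    by_contra hne
    rcases hy i with hi | hi <;> rcases hy j with hj | hj <;> rw [hi, hj] at hij
    · exact hne (haa hij)
    · exact hab' _ _ hij
    · exact hab' _ _ hij.symm
    · exact hne (hbb hij)
  have hyI : ∀ e, y e ∉ I := fun e he => by
    rcases hy e with h | h <;> rw [h] at he
    · exact (hmemI _ he).2 ⟨.inl e, rfl⟩
    · exact (hmemI _ he).2 ⟨.inr e, rfl⟩
  obtain ⟨u, huI, huc⟩ : ∃ u ∈ I, u ∉ univ.image c := by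
    refine exists_mem_notMem_of_card_lt_card ?_
    have := card_image_le (s := univ) (f := c)
    rw [card_univ, Fintype.card_fin] at this
    omega
  have hJ : #(I.erase u) = #I - 1 := card_erase_of_mem huI
  -- Match the chosen endpoints greedily into the independent set.
  obtain ⟨z, hzinj, hz⟩ : ∃ z : Fin m → V, Function.Injective z ∧
      ∀ e, z e ∈ (I.erase u).erase (c e) := by
    refine (all_card_le_biUnion_card_iff_exists_injective _).1 fun s => ?_
    obtain rfl | ⟨e, he⟩ := s.eq_empty_or_nonempty
    · simp
    · have h1 := card_le_card (subset_biUnion_of_mem (fun e => (I.erase u).erase (c e)) he)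
      have h2 := pred_card_le_card_erase (s := I.erase u) (a := c e)
      have h3 : #s ≤ m := by simpa using card_le_univ s
      omega
  simp only [mem_erase] at hz
  -- Pair up vertices of the independent set that are still unused.
  have hrest : Fintype.card (Fin (n - m) ⊕ Fin (n - m)) ≤
      Fintype.card ↥(I.erase u \ univ.image z) := by
    have h1 := le_card_sdiff (univ.image z) (I.erase u)
    rw [card_image_of_injective _ hzinj, card_univ, Fintype.card_fin] at h1
    rw [Fintype.card_coe, Fintype.card_sum, Fintype.card_fin]
    omega
  obtain ⟨w⟩ := Function.Embedding.nonempty_of_card_le hrest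
  have hw : ∀ i, ((w i : V) ≠ u ∧ (w i : V) ∈ I) ∧ ∀ e, z e ≠ w i := fun i => by
    have := (w i).2
    simp only [mem_sdiff, mem_erase, mem_image, mem_univ, true_and, not_exists] at this
    exact this
  have hwinj : ∀ i j, (w i : V) = w j → i = j := fun i j h => w.injective (Subtype.ext h)
  have huc' : ∀ e, c e ≠ u := fun e he => huc (mem_image.2 ⟨e, mem_univ _, he⟩)
  refine contains_fanGraph (ι := Fin m ⊕ Fin (n - m)) ?_ u (Sum.elim y fun i => w (.inl i))
    (Sum.elim z fun i => w (.inr i)) ?_ ?_ ?_ ?_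
  · simp only [Fintype.card_sum, Fintype.card_fin]
    omega
  · refine .sumElim (.sumElim hyinj (fun i j h => by simpa using hwinj _ _ h) ?_)
      (.sumElim hzinj (fun i j h => by simpa using hwinj _ _ h) ?_) ?_
    · exact fun i j h => hyI i (h ▸ (hw _).1.2)
    · exact fun i j => (hw _).2 i
    · rintro (i | i) (j | j) h <;> simp only [Sum.elim_inl, Sum.elim_inr] at h
      · exact hyI i (h ▸ (hz j).2.2)
      · exact hyI i (h ▸ (hw _).1.2)
      · exact (hw _).2 j h.symm
      · simpa using hwinj _ _ h
  · rintro (i | i) <;> simp only [SimpleGraph.compl_adj, Sum.elim_inl, Sum.elim_inr]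
    · exact ⟨fun h => hyI i (h ▸ huI), fun h => huc' i (hyc i u huI h.symm).symm⟩
    · exact ⟨(hw _).1.1.symm, hindep _ huI _ (hw _).1.2⟩
  · rintro (i | i) <;> simp only [SimpleGraph.compl_adj, Sum.elim_inl, Sum.elim_inr]
    · exact ⟨(hz i).2.1.symm, hindep _ huI _ (hz i).2.2⟩
    · exact ⟨(hw _).1.1.symm, hindep _ huI _ (hw _).1.2⟩
  · rintro (i | i) <;> simp only [SimpleGraph.compl_adj, Sum.elim_inl, Sum.elim_inr]
    · exact ⟨fun h => hyI i (h ▸ (hz i).2.2), fun h => (hz i).1 (hyc i _ (hz i).2.2 h)⟩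
    · exact ⟨fun h => by simpa using hwinj _ _ h, hindep _ (hw _).1.2 _ (hw _).1.2⟩

/-- If the maximum degree of a graph `G` satisfies `Δ(G) ≥ 3n`, then `G` or its
complement contains a copy of the fan `F_n`. -/
theorem fan_from_max_degree {V : Type*} [Fintype V] (n : ℕ) (hn : 0 < n)
    (G : SimpleGraph V) [DecidableRel G.Adj] (h : 3 * n ≤ G.maxDegree) :
    Contains (fanGraph n) G ∨ Contains (fanGraph n) Gᶜ := by
  have : Nonempty V := by
    by_contra hV
    rw [not_nonempty_iff] at hV
    have := G.maxDegree_of_subsingleton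
    omega
  obtain ⟨v, hv⟩ := G.exists_maximal_degree_vertex
  rw [hv, ← G.card_neighborFinset_eq_degree] at h
  by_cases hm : HasMatchingIn G (G.neighborFinset v) n
  · obtain ⟨a, b, hinj, ha, hb, hab⟩ := hm
    exact .inl (contains_fanGraph (Fintype.card_fin n) v a b hinj
      (fun i => by simpa using ha i) (fun i => by simpa using hb i) hab)
  · exact .inr (contains_fanGraph_compl_of_not_hasMatchingIn h hm)
end

section
/- Let n be a positive integer and let G be a graph on vertex set V containing a clique V_0 with |V_0| ≥ 3n/2 + 1 such that every vertex of V_0 has at least n neighbors in V \ V_0. Suppose that neither G nor its complement contains a copy of the fan F_n. Then for every vertex v ∈ V_0, there is no matching M inside the induced subgraph G[N(v)] on the neighborhood of v such that M covers at least ⌊n/2⌋ vertices outside V_0 (i.e., |V(M) \ V_0| ≥ ⌊n/2⌋). -/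
namespace SimpleGraph.Subgraph

variable {V : Type*} {G : SimpleGraph V} {M : G.Subgraph}

/-- Deleting the two ends of an edge of a matching leaves a matching. -/
lemma IsMatching.deleteVerts_pair (hM : M.IsMatching) {x y : V} (hxy : M.Adj x y) :
    (M.deleteVerts {x, y}).IsMatching := by
  rintro w ⟨hw, hwxy⟩
  obtain ⟨u, hwu, huniq⟩ := hM hw
  simp only [Set.mem_insert_iff, Set.mem_singleton_iff, not_or] at hwxy
  refine ⟨u, ?_, fun t ht ↦ huniq t ?_⟩
  · have hux : u ≠ x := by
      rintro rfl
      exact hwxy.2 (hM.eq_of_adj_left hwu.symm hxy)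
    have huy : u ≠ y := by
      rintro rfl
      exact hwxy.1 (hM.eq_of_adj_left hwu.symm hxy.symm)
    simp [hw, hwxy, hwu, M.edge_vert hwu.symm, hux, huy]
  · exact (deleteVerts_adj.mp ht).2.2.2.2

/-- A matching covering at least `2 * n` vertices contains one covering exactly `2 * n`. -/
lemma IsMatching.exists_le_ncard_verts_eq [Finite V] (hM : M.IsMatching) {n : ℕ}
    (hn : 2 * n ≤ M.verts.ncard) :
    ∃ M' ≤ M, M'.IsMatching ∧ M'.verts.ncard = 2 * n := by
  induction hk : M.verts.ncard using Nat.strong_induction_on generalizing M with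
  | _ k ih =>
    obtain heq | hlt := hn.eq_or_lt
    · exact ⟨M, le_rfl, hM, heq.symm⟩
    obtain ⟨x, hx⟩ : M.verts.Nonempty := Set.nonempty_of_ncard_ne_zero (by lia)
    obtain ⟨y, hxy, -⟩ := hM hx
    have hdel : (M.deleteVerts {x, y}).verts.ncard = M.verts.ncard - 2 := by
      rw [deleteVerts_verts, Set.ncard_sdiff (Set.pair_subset hx (M.edge_vert hxy.symm)),
        Set.ncard_pair hxy.ne]
    have heven : Even M.verts.ncard := by
      have := Fintype.ofFinite M.verts
      rw [Set.ncard_eq_toFinset_card']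
      exact hM.even_card
    obtain ⟨m, hm⟩ := heven
    obtain ⟨M', hle, hM', hcard⟩ :=
      ih _ (by lia) (hM.deleteVerts_pair hxy) (by lia) rfl
    exact ⟨M', hle.trans deleteVerts_le, hM', hcard⟩

/-- A matching inside a vertex set `S` extends to a matching inside `S` that misses at most one
vertex of a given clique contained in `S`. -/
lemma IsMatching.exists_ge_subsingleton_sdiff [Finite V] (hM : M.IsMatching) {S K : Set V}
    (hMS : M.verts ⊆ S) (hK : G.IsClique K) (hKS : K ⊆ S) :
    ∃ M' ≥ M, M'.IsMatching ∧ M'.verts ⊆ S ∧ (K \ M'.verts).Subsingleton := by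
  obtain ⟨M', hle, hmax⟩ :=
    Finite.exists_le_maximal (p := fun M : G.Subgraph ↦ M.IsMatching ∧ M.verts ⊆ S) ⟨hM, hMS⟩
  refine ⟨M', hle, hmax.prop.1, hmax.prop.2, fun x hx y hy ↦ ?_⟩
  by_contra hne
  have hxy : G.Adj x y := hK hx.1 hy.1 hne
  have hsup : (M' ⊔ G.subgraphOfAdj hxy).IsMatching := by
    refine hmax.prop.1.sup (.subgraphOfAdj hxy) ?_
    rw [hmax.prop.1.support_eq_verts, (IsMatching.subgraphOfAdj hxy).support_eq_verts,
      subgraphOfAdj_verts, Set.disjoint_right]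
    rintro z (rfl | rfl)
    exacts [hx.2, hy.2]
  have hsub : (M' ⊔ G.subgraphOfAdj hxy).verts ⊆ S := by
    rw [verts_sup, subgraphOfAdj_verts]
    exact Set.union_subset hmax.prop.2 (Set.pair_subset (hKS hx.1) (hKS hy.1))
  have hback := hmax.le_of_ge ⟨hsup, hsub⟩ le_sup_left
  exact hx.2 (verts_mono hback (by simp))

end SimpleGraph.Subgraph


/-- Let `G` contain a clique `V₀` with `|V₀| ≥ 3n/2 + 1` such that every vertex
of `V₀` has at least `n` neighbors outside `V₀`, and suppose neither `G` nor its
complement contains a copy of the fan `F_n`. Then for every `v ∈ V₀` there is no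
matching `M` in the induced subgraph `G[N(v)]` with `|V(M) \ V₀| ≥ ⌊n/2⌋`. -/
theorem no_large_outside_matching {V : Type*} [Fintype V] (n : ℕ) (hn : 0 < n)
    (G : SimpleGraph V) (V₀ : Finset V)
    (hclique : G.IsClique ↑V₀)
    (hcard : 3 * n + 2 ≤ 2 * V₀.card)
    (hdeg : ∀ v ∈ V₀, n ≤ (G.neighborSet v \ ↑V₀).ncard)
    (hG : ¬ ∃ v : V, HasFanAt G n v) (hGc : ¬ ∃ v : V, HasFanAt Gᶜ n v) :
    ∀ v ∈ V₀, ¬ ∃ M : G.Subgraph, M.IsMatching ∧ M.verts ⊆ G.neighborSet v ∧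
      n / 2 ≤ (M.verts \ ↑V₀).ncard := by
  rintro v hv ⟨M, hM, hMv, hout⟩
  have hKv : (V₀ : Set V) \ {v} ⊆ G.neighborSet v := fun x hx ↦
    hclique hv hx.1 (Ne.symm hx.2)
  obtain ⟨M', hle, hM', hM'v, hmiss⟩ :=
    hM.exists_ge_subsingleton_sdiff hMv (hclique.subset Set.sdiff_subset) hKv
  have hinside : ((V₀ : Set V) \ {v}).ncard ≤ (M'.verts ∩ V₀).ncard + 1 := by
    have hcover : (V₀ : Set V) \ {v} ⊆ M'.verts ∩ V₀ ∪ ((V₀ : Set V) \ {v}) \ M'.verts := by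
      intro x hx
      by_cases hxM : x ∈ M'.verts
      exacts [.inl ⟨hxM, hx.1⟩, .inr ⟨hx, hxM⟩]
    have hone := Set.ncard_le_one_iff_subsingleton.mpr hmiss
    have := (Set.ncard_le_ncard hcover).trans (Set.ncard_union_le _ _)
    lia
  have hV₀ : ((V₀ : Set V) \ {v}).ncard + 1 = V₀.card := by
    rw [Set.ncard_sdiff_singleton_add_one (by simpa using hv), Set.ncard_coe_finset]
  have houtside : n / 2 ≤ (M'.verts \ V₀).ncard :=
    hout.trans (Set.ncard_le_ncard (Set.sdiff_subset_sdiff_left hle.1))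
  have hsplit := Set.ncard_inter_add_ncard_sdiff_eq_ncard M'.verts V₀
  have heven : Even M'.verts.ncard := by
    classical
    rw [Set.ncard_eq_toFinset_card']
    exact hM'.even_card
  obtain ⟨m, hm⟩ := heven
  obtain ⟨F, hFle, hF, hFcard⟩ := hM'.exists_le_ncard_verts_eq (n := n) (by lia)
  exact hG ⟨v, F, hF, hFle.1.trans hM'v, hFcard⟩
end

section
/- Let n be a positive integer and let G be a graph on vertex set V containing a clique V_0 with |V_0| ≥ 3n/2 + 1 such that every vertex of V_0 has at least n neighbors in V \ V_0, and suppose that neither G nor its complement contains a copy of the fan F_n. Then for every vertex v ∈ V_0, there exists an independent set S_v ⊆ N(v) \ V_0 such that |S_v| ≥ |N(S_v) ∩ V_0| + n/2 and |N(S_v) ∩ V_0| ≤ n/2. -/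
namespace SimpleGraph

variable {V W : Type*}

/-- The graph obtained from `H` by adding the vertices of `D`, pairwise non-adjacent and
each adjacent to every vertex of `H`. -/
def joinIndep (H : SimpleGraph W) (D : Type*) : SimpleGraph (W ⊕ D) where
  Adj
    | .inl a, .inl b => H.Adj a b
    | .inr _, .inr _ => False
    | _, _ => True
  symm := ⟨by
    rintro (a | a) (b | b) h
    · exact h.symm
    · trivial
    · trivial
    · exact h⟩
  loopless := ⟨by
    rintro (a | a) h
    · exact H.irrefl h
    · exact h⟩

/-- A perfect matching of `H.joinIndep D` restricts to a matching of `H` missing exactly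
as many vertices as `D` has. -/
lemma exists_isMatching_of_joinIndep [Finite W] {D : Type*} [Finite D]
    (H : SimpleGraph W) {M : (H.joinIndep D).Subgraph} (hM : M.IsPerfectMatching) :
    ∃ N : H.Subgraph, N.IsMatching ∧ N.verts.ncard + Nat.card D = Nat.card W := by
  have hM' := Subgraph.isPerfectMatching_iff.mp hM
  let N : H.Subgraph :=
    { verts := {a | ∃ b, M.Adj (.inl a) (.inl b)}
      Adj := fun a b => M.Adj (.inl a) (.inl b)
      adj_sub := fun h => M.adj_sub h
      edge_vert := fun h => ⟨_, h⟩
      symm := ⟨fun _ _ h => Subgraph.Adj.symm h⟩ }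
  refine ⟨N, ?_, ?_⟩
  · rintro a ⟨b, hb⟩
    refine ⟨b, hb, fun c hc => ?_⟩
    exact Sum.inl_injective ((hM' (.inl a)).unique hc hb)
  · have key : ∀ x : D, ∃ a : W, M.Adj (.inr x) (.inl a) := by
      intro x
      obtain ⟨y, hy, -⟩ := hM' (.inr x)
      rcases y with a | y
      · exact ⟨a, hy⟩
      · exact (M.adj_sub hy).elim
    choose g hg using key
    have hginj : Function.Injective g := by
      intro x y h
      have h1 := (hg x).symm
      rw [h] at h1
      exact Sum.inr_injective ((hM' (.inl (g y))).unique h1 (hg y).symm)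
    have hrange : Set.range g = N.vertsᶜ := by
      ext a
      constructor
      · rintro ⟨x, rfl⟩ ⟨b, hb⟩
        cases (hM' (.inl (g x))).unique (hg x).symm hb
      · intro ha
        obtain ⟨y, hy, -⟩ := hM' (.inl a)
        rcases y with b | x
        · exact (ha ⟨b, hy⟩).elim
        · exact ⟨x, Sum.inl_injective ((hM' (.inr x)).unique (hg x) hy.symm)⟩
    have h1 : (Set.range g).ncard = Nat.card D := by
      rw [← Nat.card_coe_set_eq, Nat.card_range_of_injective hginj]
    rw [← h1, hrange, Set.ncard_add_ncard_compl]

/-- A consequence of the Tutte–Berge formula: if no matching of `H` misses exactly `d` vertices,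
then deleting some set `T` leaves at least `|T| + d + 2` components. -/
lemma exists_card_connectedComponent_of_forall_isMatching [Finite W] (H : SimpleGraph W) (d : ℕ)
    (hd : d ≤ Nat.card W) (heven : Even (Nat.card W + d))
    (h : ∀ N : H.Subgraph, N.IsMatching → N.verts.ncard + d ≠ Nat.card W) :
    ∃ T : Set W, T.ncard + d + 2 ≤ Nat.card (H.induce Tᶜ).ConnectedComponent := by
  classical
  let J := H.joinIndep (Fin d)
  have hno : ¬ ∃ M : J.Subgraph, M.IsPerfectMatching := by
    rintro ⟨M, hM⟩
    obtain ⟨N, hN, hc⟩ := exists_isMatching_of_joinIndep H hM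
    exact h N hN (by simpa using hc)
  rw [tutte] at hno
  push Not at hno
  obtain ⟨U, hU⟩ := hno
  unfold IsTutteViolator at hU
  set K := ((⊤ : J.Subgraph).deleteVerts U).coe with hK
  have hverts : ((⊤ : J.Subgraph).deleteVerts U).verts = Uᶜ := by
    ext x; simp
  have hpar := odd_ncard_oddComponents K
  rw [Nat.card_coe_set_eq, congrArg Set.ncard hverts] at hpar
  have hUc := Set.ncard_add_ncard_compl U
  have hcardJ : Nat.card (W ⊕ Fin d) = Nat.card W + d := by simp [Nat.card_sum]
  rw [hcardJ] at hUc
  have hodd : U.ncard + 2 ≤ K.oddComponents.ncard := by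
    by_contra hlt
    have heq : K.oddComponents.ncard = U.ncard + 1 := by omega
    rw [heq] at hpar
    rw [← hUc] at heven
    simp only [Nat.odd_iff, Nat.even_iff] at hpar heven
    omega
  have hcomp : U.ncard + 2 ≤ Nat.card K.ConnectedComponent :=
    hodd.trans (Set.ncard_le_card _)
  have hKadj : ∀ x y : ((⊤ : J.Subgraph).deleteVerts U).verts, J.Adj x.1 y.1 → K.Adj x y := by
    rintro ⟨x, hx⟩ ⟨y, hy⟩ hxy
    have hx' : x ∉ U := by simpa using hx
    have hy' : y ∉ U := by simpa using hy
    simp [hK, hx', hy', hxy]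
  have hsub : ∀ i : Fin d, Sum.inr i ∈ U := by
    intro i
    by_contra hi
    by_cases hall : ∀ a : W, Sum.inl a ∈ U
    · have h1 : Nat.card W ≤ U.ncard := by
        have : Set.range (Sum.inl : W → W ⊕ Fin d) ⊆ U := by
          rintro _ ⟨a, rfl⟩; exact hall a
        have h2 := Set.ncard_le_ncard this
        rwa [← Nat.card_coe_set_eq, Nat.card_range_of_injective Sum.inl_injective] at h2
      have h2 : Nat.card K.ConnectedComponent ≤ (Uᶜ : Set (W ⊕ Fin d)).ncard := by
        rw [← hverts, ← Nat.card_coe_set_eq]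
        exact Nat.card_le_card_of_surjective K.connectedComponentMk Quot.mk_surjective
      omega
    · push Not at hall
      obtain ⟨a, ha⟩ := hall
      have hiv : Sum.inr i ∈ ((⊤ : J.Subgraph).deleteVerts U).verts := by rw [hverts]; exact hi
      have hav : Sum.inl a ∈ ((⊤ : J.Subgraph).deleteVerts U).verts := by rw [hverts]; exact ha
      have hia : K.Adj ⟨_, hiv⟩ ⟨_, hav⟩ := hKadj _ _ trivial
      have hreach : ∀ x, K.Reachable ⟨_, hiv⟩ x := by
        rintro ⟨b | j, hx⟩
        · exact (hKadj ⟨_, hiv⟩ ⟨_, hx⟩ trivial).reachable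
        · exact hia.reachable.trans (hKadj ⟨_, hav⟩ ⟨_, hx⟩ trivial).reachable
      have hss : Subsingleton K.ConnectedComponent := by
        refine ⟨fun c c' => ?_⟩
        induction c using ConnectedComponent.ind with | h x =>
        induction c' using ConnectedComponent.ind with | h y =>
        exact ConnectedComponent.sound ((hreach x).symm.trans (hreach y))
      have := Finite.card_le_one_iff_subsingleton.mpr hss
      omega
  refine ⟨Sum.inl ⁻¹' U, ?_⟩
  have hcardU : (Sum.inl ⁻¹' U : Set W).ncard + d = U.ncard := by
    have hdecomp : U = Sum.inl '' (Sum.inl ⁻¹' U : Set W) ∪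
        Set.range (Sum.inr : Fin d → W ⊕ Fin d) := by
      ext (a | i)
      · simp
      · simp [hsub i]
    have hdisj : Disjoint (Sum.inl '' (Sum.inl ⁻¹' U : Set W))
        (Set.range (Sum.inr : Fin d → W ⊕ Fin d)) := by
      rw [Set.disjoint_left]
      rintro _ ⟨a, -, rfl⟩ ⟨i, hi⟩
      cases hi
    conv_rhs => rw [hdecomp]
    rw [Set.ncard_union_eq hdisj, Set.ncard_image_of_injective _ Sum.inl_injective,
      ← Nat.card_coe_set_eq (Set.range _), Nat.card_range_of_injective Sum.inr_injective]
    simp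
  rw [hcardU]
  let f : H.induce (Sum.inl ⁻¹' U : Set W)ᶜ →g K :=
    { toFun := fun a => ⟨.inl a.1, by rw [hverts]; exact a.2⟩
      map_rel' := fun {a b} hab => hKadj _ _ hab }
  refine hcomp.trans (Nat.card_le_card_of_surjective (ConnectedComponent.map f) ?_)
  intro c
  induction c using ConnectedComponent.ind with | h x =>
  obtain ⟨x | i, hx⟩ := x
  · refine ⟨connectedComponentMk _ ⟨x, ?_⟩, rfl⟩
    rw [hverts] at hx
    exact hx
  · rw [hverts] at hx
    exact (hx (hsub i)).elim

/-- In a clique `P` all of whose vertices are adjacent to all of `Q`, with `P` and `Q` disjoint,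
`|P| ≥ n` and `|P| + |Q| ≥ 2n`, there is a matching covering `2n` vertices. -/
lemma IsClique.exists_isMatching_of_forall_adj {G : SimpleGraph V} {P Q : Finset V} {n : ℕ}
    (hP : G.IsClique (P : Set V)) (hPQ : ∀ p ∈ P, ∀ q ∈ Q, G.Adj p q)
    (hn : n ≤ P.card) (hcard : 2 * n ≤ P.card + Q.card) :
    ∃ M : G.Subgraph, M.IsMatching ∧ M.verts ⊆ (P : Set V) ∪ Q ∧ M.verts.ncard = 2 * n := by
  classical
  have hdisj : Disjoint P Q :=
    Finset.disjoint_left.mpr fun a ha hb => G.irrefl (hPQ a ha a hb)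
  obtain ⟨Q', hQ', hQc⟩ := Finset.exists_subset_card_eq (min_le_right n Q.card)
  obtain ⟨P', hP', hPc⟩ := Finset.exists_subset_card_eq
    (show 2 * n - min n Q.card ≤ P.card by omega)
  obtain ⟨P₁, hP₁, hP₁c⟩ := Finset.exists_subset_card_eq
    (show min n Q.card ≤ P'.card by omega)
  have hP₂c : (P' \ P₁).card = 2 * (n - min n Q.card) := by
    rw [Finset.card_sdiff_of_subset hP₁]; omega
  have hd1 : Disjoint (P₁ : Set V) Q' := by
    rw [Finset.disjoint_coe]
    exact hdisj.mono (hP₁.trans hP') hQ'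
  have e : P₁ ≃ Q' := Finset.equivOfCardEq (hP₁c.trans hQc.symm)
  obtain ⟨M₁, hM₁v, hM₁⟩ := Subgraph.IsMatching.exists_of_disjoint_sets_of_equiv
    (G := G) hd1 e (fun v => hPQ _ (hP' (hP₁ v.2)) _ (hQ' (e v).2))
  obtain ⟨M₂, hM₂v, hM₂⟩ := ((hP.subset (show ((P' \ P₁ : Finset V) : Set V) ⊆ P from
    Finset.coe_subset.mpr (Finset.sdiff_subset.trans hP'))).even_iff_exists_isMatching
    (Finset.finite_toSet _)).mp (by rw [Set.ncard_coe_finset, hP₂c]; exact even_two_mul _)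
  have hd2 : Disjoint (P₁ ∪ Q') (P' \ P₁) := by
    rw [Finset.disjoint_union_left]
    exact ⟨Finset.disjoint_sdiff, (hdisj.mono (Finset.sdiff_subset.trans hP') hQ').symm⟩
  have hv : (M₁ ⊔ M₂).verts = ((P₁ ∪ Q') ∪ (P' \ P₁) : Finset V) := by
    rw [Subgraph.verts_sup, hM₁v, hM₂v]; push_cast; rfl
  refine ⟨M₁ ⊔ M₂, hM₁.sup hM₂ ?_, ?_, ?_⟩
  · rw [hM₁.support_eq_verts, hM₂.support_eq_verts, hM₁v, hM₂v, ← Finset.coe_union,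
      Finset.disjoint_coe]
    exact hd2
  · rw [hv, ← Finset.coe_union, Finset.coe_subset]
    refine Finset.union_subset (Finset.union_subset_union (hP₁.trans hP') hQ') ?_
    exact (Finset.sdiff_subset.trans hP').trans Finset.subset_union_left
  · rw [hv, Set.ncard_coe_finset, Finset.card_union_of_disjoint hd2,
      Finset.card_union_of_disjoint (Finset.disjoint_coe.mp hd1)]
    omega

/-- If `T` separates the neighborhood of a vertex `v` of a clique `C` into `m + 1` components,
then there are `m` pairwise non-adjacent neighbors of `v` outside `C` whose neighbors in `C`
all lie in `T ∪ {v}`. -/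
lemma IsClique.exists_indep_of_card_connectedComponent [Finite V] {G : SimpleGraph V} {C : Set V}
    (hC : G.IsClique C) {v : V} (hv : v ∈ C) (T : Set (G.neighborSet v)) {m : ℕ}
    (hm : m + 1 ≤ Nat.card ((G.induce (G.neighborSet v)).induce Tᶜ).ConnectedComponent) :
    ∃ S : Finset V, ↑S ⊆ G.neighborSet v \ C ∧ (∀ a ∈ S, ∀ b ∈ S, ¬ G.Adj a b) ∧ m ≤ S.card ∧
      {u ∈ C | ∃ w ∈ S, G.Adj w u}.ncard ≤ T.ncard + 1 := by
  classical
  set K := (G.induce (G.neighborSet v)).induce Tᶜ with hK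
  let rep : K.ConnectedComponent → V := fun c => c.out.1.1
  have hrep : Function.Injective rep := fun c c' h =>
    (Quot.out_eq c).symm.trans
      ((congrArg K.connectedComponentMk (Subtype.ext (Subtype.ext h))).trans (Quot.out_eq c'))
  let bad : Set K.ConnectedComponent := {c | ∃ x, K.connectedComponentMk x = c ∧ x.1.1 ∈ C}
  have hbad : bad.Subsingleton := by
    rintro _ ⟨x, rfl, hx⟩ _ ⟨y, rfl, hy⟩
    by_cases hxy : x = y
    · rw [hxy]
    · refine ConnectedComponent.sound (Adj.reachable ?_)
      exact hC hx hy fun h => hxy (Subtype.ext (Subtype.ext h))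
  have hgood : m ≤ (badᶜ).ncard := by
    have h1 := Set.ncard_add_ncard_compl bad
    have h2 : bad.ncard ≤ 1 := Set.ncard_le_one_iff_subsingleton.mpr hbad
    omega
  have hfin : (rep '' badᶜ).Finite := Set.toFinite _
  have hadj : ∀ c : K.ConnectedComponent, ∀ x, G.Adj (rep c) x.1.1 →
      K.connectedComponentMk x = c := by
    intro c x h
    have : K.Adj c.out x := h
    exact (ConnectedComponent.sound this.reachable.symm).trans (Quot.out_eq c)
  refine ⟨hfin.toFinset, ?_, ?_, ?_, ?_⟩
  · rw [Set.Finite.coe_toFinset]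
    rintro _ ⟨c, hc, rfl⟩
    exact ⟨c.out.1.2, fun h => hc ⟨c.out, Quot.out_eq c, h⟩⟩
  · intro a ha b hb hab
    rw [Set.Finite.mem_toFinset] at ha hb
    obtain ⟨c, -, rfl⟩ := ha
    obtain ⟨c', -, rfl⟩ := hb
    have h1 : c' = c := (Quot.out_eq c').symm.trans (hadj c c'.out hab)
    subst h1
    exact G.irrefl hab
  · rw [← Set.ncard_eq_toFinset_card _ hfin, Set.ncard_image_of_injective _ hrep]
    exact hgood
  · have hsub : {u ∈ C | ∃ w ∈ hfin.toFinset, G.Adj w u} ⊆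
        Set.insert v (Subtype.val '' T) := by
      rintro u ⟨huC, w, hw, hwu⟩
      rw [Set.Finite.mem_toFinset] at hw
      obtain ⟨c, hc, rfl⟩ := hw
      by_cases huv : u = v
      · exact Or.inl huv
      · right
        have huN : u ∈ G.neighborSet v := hC hv huC (Ne.symm huv)
        by_contra hT
        have hT' : (⟨u, huN⟩ : G.neighborSet v) ∈ Tᶜ := fun h => hT ⟨_, h, rfl⟩
        exact hc ⟨⟨_, hT'⟩, hadj c ⟨_, hT'⟩ hwu, huC⟩
    refine (Set.ncard_le_ncard hsub).trans ((Set.ncard_insert_le _ _).trans ?_)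
    rw [Set.ncard_image_of_injective _ Subtype.val_injective]

end SimpleGraph


/-- Let `G` contain a clique `V₀` with `|V₀| ≥ 3n/2 + 1` such that every vertex
of `V₀` has at least `n` neighbors outside `V₀`, and suppose neither `G` nor its
complement contains a copy of the fan `F_n`. Then for every `v ∈ V₀` there is an
independent set `S ⊆ N(v) \ V₀` with `|S| ≥ |N(S) ∩ V₀| + n/2` and
`|N(S) ∩ V₀| ≤ n/2`. -/
theorem exists_indep_set {V : Type*} [Fintype V] (n : ℕ) (hn : 0 < n)
    (G : SimpleGraph V) (V₀ : Finset V)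
    (hclique : G.IsClique ↑V₀)
    (hcard : 3 * n + 2 ≤ 2 * V₀.card)
    (hdeg : ∀ v ∈ V₀, n ≤ (G.neighborSet v \ ↑V₀).ncard)
    (hG : ¬ ∃ v : V, HasFanAt G n v) (hGc : ¬ ∃ v : V, HasFanAt Gᶜ n v) :
    ∀ v ∈ V₀, ∃ S : Finset V,
      ↑S ⊆ G.neighborSet v \ ↑V₀ ∧
      (∀ a ∈ S, ∀ b ∈ S, ¬ G.Adj a b) ∧
      2 * {u ∈ (V₀ : Set V) | ∃ w ∈ S, G.Adj w u}.ncard + n ≤ 2 * S.card ∧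
      2 * {u ∈ (V₀ : Set V) | ∃ w ∈ S, G.Adj w u}.ncard ≤ n := by
  classical
  intro v hv
  have hW : 5 * n ≤ 2 * Nat.card (G.neighborSet v) := by
    have hd := hdeg v hv
    have hdisj : Disjoint (G.neighborSet v \ ↑V₀) (↑(V₀.erase v) : Set V) := by
      rw [Set.disjoint_left]
      rintro x ⟨-, hx⟩ hx'
      exact hx (Finset.mem_of_mem_erase hx')
    have hsub : (G.neighborSet v \ ↑V₀) ∪ (↑(V₀.erase v) : Set V) ⊆ G.neighborSet v := by
      rintro x (hx | hx)
      · exact hx.1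
      · have hx' := Finset.mem_erase.mp (Finset.mem_coe.mp hx)
        exact hclique hv hx'.2 hx'.1.symm
    have h1 := Set.ncard_le_ncard hsub
    rw [Set.ncard_union_eq hdisj, Set.ncard_coe_finset, Finset.card_erase_of_mem hv] at h1
    rw [Nat.card_coe_set_eq]
    omega
  obtain ⟨T, hT⟩ :=
    (G.induce (G.neighborSet v)).exists_card_connectedComponent_of_forall_isMatching
      (Nat.card (G.neighborSet v) - 2 * n) (Nat.sub_le _ _)
      (by rw [Nat.even_iff]; omega) (by
        intro N hN hc
        let f := (SimpleGraph.Embedding.induce (G := G) (G.neighborSet v)).toHom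
        have hinj : Function.Injective f := Subtype.val_injective
        refine hG ⟨v, N.map f, hN.map _ hinj, ?_, ?_⟩
        · rintro _ ⟨x, -, rfl⟩
          exact x.2
        · rw [SimpleGraph.Subgraph.map_verts, Set.ncard_image_of_injective _ hinj]
          omega)
  obtain ⟨S, hSsub, hSind, hScard, hSN⟩ := hclique.exists_indep_of_card_connectedComponent hv T
    (m := T.ncard + (Nat.card (G.neighborSet v) - 2 * n) + 1) hT
  have hlarge : 2 * {u ∈ (V₀ : Set V) | ∃ w ∈ S, G.Adj w u}.ncard + n ≤ 2 * S.card := by omega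
  refine ⟨S, hSsub, hSind, hlarge, ?_⟩
  by_contra! hlt
  have hSV : ∀ a ∈ S, a ∉ V₀ := fun a ha => (hSsub ha).2
  obtain ⟨s, hs⟩ : S.Nonempty := Finset.card_pos.mp (by omega)
  let Q := V₀.filter fun u => ¬ ∃ w ∈ S, G.Adj w u
  have hQ : {u ∈ (V₀ : Set V) | ∃ w ∈ S, G.Adj w u}.ncard + Q.card = V₀.card := by
    rw [← Finset.card_filter_add_card_filter_not (s := V₀) (fun u => ∃ w ∈ S, G.Adj w u),
      ← Set.ncard_coe_finset (V₀.filter fun u => ∃ w ∈ S, G.Adj w u), Finset.coe_filter]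
    rfl
  have hSQ : ∀ a ∈ S, ∀ q ∈ Q, Gᶜ.Adj a q := by
    intro a ha q hq
    obtain ⟨hqV, hq⟩ := Finset.mem_filter.mp hq
    exact ⟨fun h => hSV a ha (h ▸ hqV), fun h => hq ⟨a, ha, h⟩⟩
  have hSS : Gᶜ.IsClique (S : Set V) := fun a ha b hb hab => ⟨hab, hSind a ha b hb⟩
  have hPcard := Finset.card_erase_of_mem hs
  obtain ⟨M, hM, hMv, hMc⟩ := (hSS.subset
    (Finset.coe_subset.mpr (S.erase_subset s))).exists_isMatching_of_forall_adj (n := n) (Q := Q)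
    (fun p hp => hSQ p (Finset.mem_of_mem_erase hp)) (by omega) (by omega)
  refine hGc ⟨s, M, hM, fun x hx => ?_, hMc⟩
  rcases hMv hx with hx | hx
  · have hx' := Finset.mem_erase.mp (Finset.mem_coe.mp hx)
    exact hSS hs hx'.2 hx'.1.symm
  · exact hSQ s hs x hx
end

section
/- Let n be an even positive integer. There exists a graph G on 9n/2 - 2 vertices containing a clique V_0 of order 3n/2 such that every vertex v ∈ V_0 has exactly n neighbors in V(G) \ V_0, yet neither G nor its complement contains a copy of the fan F_n whose center lies in V_0. (Hence the bound |V_0| ≥ 3n/2 + 1 in the fan-finding lemma cannot be weakened to |V_0| ≥ 3n/2.) -/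
/-- If every vertex of a matching `M` outside `T` lies in `S` or is matched into `S`, then `M`
covers at most `2 * |S| + |T|` vertices. -/
theorem SimpleGraph.Subgraph.IsMatching.ncard_verts_le {V : Type*} [DecidableEq V]
    {G : SimpleGraph V} {M : G.Subgraph} (hM : M.IsMatching) (S T : Finset V)
    (h : ∀ x y, M.Adj x y → x ∉ T → x ∈ S ∨ y ∈ S) :
    M.verts.ncard ≤ 2 * S.card + T.card := by
  classical
  have hex : ∀ x, ∃ y, x ∈ M.verts → M.Adj x y := fun x => by
    by_cases hx : x ∈ M.verts
    · obtain ⟨y, hy, -⟩ := hM hx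
      exact ⟨y, fun _ => hy⟩
    · exact ⟨x, fun hx' => absurd hx' hx⟩
  choose f hf using hex
  have hsub : M.verts ⊆ ↑(S ∪ S.image f ∪ T) := by
    intro x hx
    have hxy := hf x hx
    by_cases hT : x ∈ T
    · simp [hT]
    · rcases h x (f x) hxy hT with hS | hS
      · simp [hS]
      · have hfx : f (f x) = x :=
          (hM (M.edge_vert hxy.symm)).unique (hf _ (M.edge_vert hxy.symm)) hxy.symm
        have hmem : x ∈ S.image f := Finset.mem_image.2 ⟨f x, hS, hfx⟩
        simp only [Finset.coe_union, Set.mem_union, Finset.mem_coe]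
        exact Or.inl (Or.inr hmem)
  have hle := Set.ncard_le_ncard hsub (Finset.finite_toSet _)
  rw [Set.ncard_coe_finset] at hle
  have h₁ := Finset.card_union_le (S ∪ S.image f) T
  have h₂ := Finset.card_union_le S (S.image f)
  have h₃ := Finset.card_image_le (s := S) (f := f)
  omega

/-- The graph on `Fin N` in which the vertices below `3 * m` form a clique, the remaining vertices
are independent, and a clique vertex is adjacent to the vertex `9 * m - 3` and to the other
independent vertices in its residue class modulo `3`. -/
def residueGraph (m N : ℕ) : SimpleGraph (Fin N) where
  Adj i j := i ≠ j ∧ (i.val < 3 * m ∨ j.val < 3 * m) ∧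
    (i.val < 3 * m ∧ j.val < 3 * m ∨ i.val = 9 * m - 3 ∨ j.val = 9 * m - 3 ∨
      i.val % 3 = j.val % 3)
  symm := ⟨fun i j h => by grind⟩
  loopless := ⟨fun i h => h.1 rfl⟩

theorem residueGraph_adj {m N : ℕ} {i j : Fin N} :
    (residueGraph m N).Adj i j ↔ i ≠ j ∧ (i.val < 3 * m ∨ j.val < 3 * m) ∧
      (i.val < 3 * m ∧ j.val < 3 * m ∨ i.val = 9 * m - 3 ∨ j.val = 9 * m - 3 ∨
        i.val % 3 = j.val % 3) :=
  Iff.rfl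

/-- The vertices of `Fin N` in `[3 * a, 3 * b)` with residue `r` modulo `3`. -/
def residueClass (N a b r : ℕ) : Finset (Fin N) :=
  {u | 3 * a ≤ u.val ∧ u.val < 3 * b ∧ u.val % 3 = r}

theorem mem_residueClass {N a b r : ℕ} {u : Fin N} :
    u ∈ residueClass N a b r ↔ 3 * a ≤ u.val ∧ u.val < 3 * b ∧ u.val % 3 = r := by
  simp [residueClass]

theorem card_residueClass {N a b r : ℕ} (hr : r < 3) (hb : 3 * b ≤ N) :
    (residueClass N a b r).card = b - a := by
  rw [← Nat.card_Ico]
  refine Finset.card_bij (fun u _ => u.val / 3) ?_ ?_ ?_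
  · intro u hu
    rw [mem_residueClass] at hu
    rw [Finset.mem_Ico]
    omega
  · intro u hu w hw h
    rw [mem_residueClass] at hu hw
    apply Fin.ext
    omega
  · intro k hk
    rw [Finset.mem_Ico] at hk
    exact ⟨⟨3 * k + r, by omega⟩, mem_residueClass.2 (by grind), by grind⟩

/-- The clique of `residueGraph m N`. -/
def residueClique (m N : ℕ) : Finset (Fin N) := {u | u.val < 3 * m}

theorem mem_residueClique {m N : ℕ} {u : Fin N} : u ∈ residueClique m N ↔ u.val < 3 * m := by
  simp [residueClique]

theorem card_residueClique {m N : ℕ} (h : 3 * m ≤ N) : (residueClique m N).card = 3 * m := by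
  rw [residueClique, Fin.card_filter_val_lt]
  omega

theorem isClique_residueClique (m N : ℕ) : (residueGraph m N).IsClique ↑(residueClique m N) := by
  intro u hu w hw huw
  rw [Finset.mem_coe, mem_residueClique] at hu hw
  exact ⟨huw, Or.inl hu, Or.inl ⟨hu, hw⟩⟩

theorem ncard_neighborSet_residueGraph_diff {m N : ℕ} (hm : 0 < m) (hN : N = 9 * m - 2)
    {v : Fin N} (hv : v ∈ residueClique m N) :
    ((residueGraph m N).neighborSet v \ ↑(residueClique m N)).ncard = 2 * m := by
  have heq : (residueGraph m N).neighborSet v \ ↑(residueClique m N) =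
      ↑(insert (⟨9 * m - 3, by omega⟩ : Fin N)
        (residueClass N m (3 * m - 1) (v.val % 3))) := by
    ext u
    rw [mem_residueClique] at hv
    simp only [Set.mem_sdiff, SimpleGraph.mem_neighborSet, residueGraph_adj, Finset.mem_coe,
      mem_residueClique, Finset.mem_insert, mem_residueClass, Fin.ext_iff, ne_eq]
    omega
  rw [heq, Set.ncard_coe_finset, Finset.card_insert_of_notMem,
    card_residueClass (by omega) (by omega)]
  · omega
  · rw [mem_residueClass]
    grind

theorem not_hasFanAt_residueGraph {m N : ℕ} (hm : 0 < m) (hN : N = 9 * m - 2)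
    {v : Fin N} (hv : v ∈ residueClique m N) :
    ¬ HasFanAt (residueGraph m N) (2 * m) v := by
  rintro ⟨M, hM, hsub, hcard⟩
  have hle := hM.ncard_verts_le ((residueClass N 0 m (v.val % 3)).erase v)
    (insert (⟨9 * m - 3, by omega⟩ : Fin N)
      (residueClique m N \ residueClass N 0 m (v.val % 3))) ?_
  · rw [mem_residueClique] at hv
    have hS := Finset.card_erase_of_mem
      (mem_residueClass.2 (by omega) : v ∈ residueClass N 0 m (v.val % 3))
    have hT := Finset.card_insert_le (⟨9 * m - 3, by omega⟩ : Fin N)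
      (residueClique m N \ residueClass N 0 m (v.val % 3))
    rw [Finset.card_sdiff_of_subset, card_residueClique (by omega)] at hT
    · rw [card_residueClass (by omega) (by omega)] at hS hT
      omega
    · intro u hu
      rw [mem_residueClass] at hu
      exact mem_residueClique.2 hu.2.1
  · intro x y hxy hx
    have hvx := hsub (M.edge_vert hxy)
    have hvy := hsub (M.edge_vert hxy.symm)
    have hG := M.adj_sub hxy
    rw [mem_residueClique] at hv
    simp only [SimpleGraph.mem_neighborSet, residueGraph_adj, Finset.mem_insert,
      Finset.mem_sdiff, Finset.mem_erase, mem_residueClique, mem_residueClass, Fin.ext_iff,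
      ne_eq] at hvx hvy hG hx ⊢
    omega

theorem not_hasFanAt_compl_residueGraph {m N : ℕ} (hm : 0 < m) (hN : N = 9 * m - 2)
    {v : Fin N} (hv : v ∈ residueClique m N) :
    ¬ HasFanAt (residueGraph m N)ᶜ (2 * m) v := by
  rintro ⟨M, -, hsub, hcard⟩
  have hsub' : M.verts ⊆ (↑(residueClique m N) : Set (Fin N))ᶜ \
      ((residueGraph m N).neighborSet v \ ↑(residueClique m N)) := by
    intro u hu
    obtain ⟨hne, hadj⟩ := (SimpleGraph.compl_adj _ _ _).1 (hsub hu)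
    exact ⟨fun huV => hadj (isClique_residueClique m N hv huV hne), fun hu' => hadj hu'.1⟩
  have hle := Set.ncard_le_ncard hsub' (Set.toFinite _)
  rw [Set.ncard_sdiff (fun u hu => hu.2) (Set.toFinite _),
    ncard_neighborSet_residueGraph_diff hm hN hv, Set.ncard_compl, Set.ncard_coe_finset,
    card_residueClique (by omega), Nat.card_eq_fintype_card, Fintype.card_fin] at hle
  omega


/-- For every even positive integer `n` there is a graph `G` on `9n/2 - 2`
vertices containing a clique `V₀` of order `3n/2` such that every vertex of `V₀`
has exactly `n` neighbors outside `V₀`, yet neither `G` nor its complement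
contains a copy of the fan `F_n` with center in `V₀`. -/
theorem fan_lemma_tight (n : ℕ) (hn : 0 < n) (heven : Even n) :
    ∃ (G : SimpleGraph (Fin (9 * n / 2 - 2))) (V₀ : Finset (Fin (9 * n / 2 - 2))),
      G.IsClique ↑V₀ ∧
      2 * V₀.card = 3 * n ∧
      (∀ v ∈ V₀, (G.neighborSet v \ ↑V₀).ncard = n) ∧
      (∀ v ∈ V₀, ¬ HasFanAt G n v) ∧
      (∀ v ∈ V₀, ¬ HasFanAt Gᶜ n v) := by
  obtain ⟨m, rfl⟩ := heven.exists_two_nsmul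
  rw [smul_eq_mul] at hn ⊢
  have hm : 0 < m := by omega
  have hN : 9 * (2 * m) / 2 - 2 = 9 * m - 2 := by omega
  refine ⟨residueGraph m _, residueClique m _, isClique_residueClique m _, ?_,
    fun v hv => ncard_neighborSet_residueGraph_diff hm hN hv,
    fun v hv => not_hasFanAt_residueGraph hm hN hv,
    fun v hv => not_hasFanAt_compl_residueGraph hm hN hv⟩
  rw [card_residueClique (by omega)]
  omega
end
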